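/- arXiv:2311.01750 — 2 statements merged into one kernel-verified Lean document; each statement's English description precedes it below -/
import Mathlib

section
/- (Strong Graph-Like Regularity Lemma for 3-graphs.) For every real δ₃ > 0, every function δ₂ : ℕ → (0,1], every function r : ℕ² → ℕ, and all positive integers ℓ₀, t₀, s, there exist positive integers n₀ and T such that the following holds for every n ≥ n₀. For every sequence (H₁,…,H_s) of n-vertex 3-graphs on a common vertex set V, there are integers t and ℓ with t₀ ≤ t ≤ T and ℓ₀ ≤ ℓ ≤ T, a vertex partition 𝒱: V = V₁ ∪ … ∪ V_t, and an ℓ-equitable partition ℬ of K^(2)(𝒱) with respect to 𝒱, such that: (R.1) |V₁| ≤ |V₂| ≤ … ≤ |V_t| ≤ |V₁| + 1; (R.2) for all 1 ≤ i < j ≤ t and α ∈ [ℓ], the bipartite graph B^{ij}_α is (δ₂(ℓ), 1/ℓ)-regular; (R.3) H_i is δ₂(ℓ)-weakly-regular with respect to 𝒱 for every i ∈ [s]; and (R.4) H_i is (δ₃, r(t,ℓ))-regular with respect to ℬ for every i ∈ [s]. -/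
open Finset Filter

attribute [local instance] Classical.propDecidable

/-- A hypergraph: a finite vertex set and a finite edge set (edges are finite
vertex sets; for 3-graphs all edges have three elements). -/
structure H3 where
  verts : Finset ℕ
  edges : Finset (Finset ℕ)

/-- The subhypergraph relation. -/
def H3.Sub (F H : H3) : Prop :=
  F.verts ⊆ H.verts ∧ F.edges ⊆ H.edges ∧ ∀ e ∈ F.edges, e ⊆ F.verts

/-- The density `d₃` of a 3-graph. -/
noncomputable def d3 (F : H3) : ℝ :=
  if F.edges.card = 0 then 0
  else if F.edges.card = 1 ∧ F.verts.card = 3 then 1 / 3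
  else ((F.edges.card : ℝ) - 1) / ((F.verts.card : ℝ) - 3)

/-- The maximal 3-density `m₃`. -/
noncomputable def m3 (H : H3) : ℝ :=
  sSup {x : ℝ | ∃ F : H3, F.Sub H ∧ x = d3 F}

/-- The asymmetric maximal 3-density `m₃(H₁,H₂)`. -/
noncomputable def m3Asym (H1 H2 : H3) : ℝ :=
  sSup {x : ℝ | ∃ F : H3, F.Sub H1 ∧ 1 ≤ F.edges.card ∧
    x = (F.edges.card : ℝ) / ((F.verts.card : ℝ) - 3 + 1 / m3 H2)}

/-- The maximum subhypergraph density `m(H)`. -/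
noncomputable def mDen (H : H3) : ℝ :=
  sSup {x : ℝ | ∃ F : H3, F.Sub H ∧ 1 ≤ F.verts.card ∧
    x = (F.edges.card : ℝ) / (F.verts.card : ℝ)}

/-- The canonical linear 3-clique `K̃_t`: branch vertices `0,…,t-1`; the pair
`(i,j)` with `i<j<t` gets the apex vertex `t + (C(j,2) + i)`, and the map
`(i,j) ↦ C(j,2) + i` is a bijection onto `[0, C(t,2))`. -/
noncomputable def linClique (t : ℕ) : H3 where
  verts := Finset.range (t + t.choose 2)
  edges := ((Finset.range t ×ˢ Finset.range t).filter fun p => p.1 < p.2).image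
    fun p => {p.1, p.2, t + (p.2.choose 2 + p.1)}

/-- `v(K̃_t)`. -/
def vOf (t : ℕ) : ℕ := t + t.choose 2

/-- `(cV, cE)` is a copy of the hypergraph `F` (an isomorphic image of `F`). -/
def IsCopy3 (F : H3) (cV : Finset ℕ) (cE : Finset (Finset ℕ)) : Prop :=
  ∃ φ : ℕ → ℕ, Set.InjOn φ ↑F.verts ∧ cV = F.verts.image φ ∧
    cE = F.edges.image fun e => e.image φ

/-- The edge set `E` contains a copy of the hypergraph `F`. -/
def ContainsCopy (F : H3) (E : Finset (Finset ℕ)) : Prop :=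
  ∃ cV cE, IsCopy3 F cV cE ∧ cE ⊆ E

/-- The edge set `E` induced on `U` contains a copy of the hypergraph `F`. -/
def ContainsCopyWithin (F : H3) (E : Finset (Finset ℕ)) (U : Finset ℕ) : Prop :=
  ∃ cV cE, IsCopy3 F cV cE ∧ cV ⊆ U ∧ cE ⊆ E

/-- The probability that the binomial random 3-graph `ℍ(n,p)` satisfies `P`. -/
noncomputable def PrH (n : ℕ) (p : ℝ) (P : Finset (Finset ℕ) → Prop) : ℝ :=
  ∑ R ∈ ((Finset.range n).powersetCard 3).powerset,
    if P R then p ^ R.card * (1 - p) ^ (((Finset.range n).powersetCard 3).card - R.card)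
    else 0

/-- `E → (F)₂` : every 2-colouring of `E` yields a monochromatic copy of `F`. -/
def Arrow2 (E : Finset (Finset ℕ)) (F : H3) : Prop :=
  ∀ χ : Finset ℕ → Bool, ∃ c : Bool, ContainsCopy F (E.filter fun e => χ e = c)

/-- `E → (F, F')` : every red/blue colouring of `E` yields a red copy of `F`
or a blue copy of `F'`. -/
def ArrowAsym (E : Finset (Finset ℕ)) (F F' : H3) : Prop :=
  ∀ χ : Finset ℕ → Bool,
    ContainsCopy F (E.filter fun e => χ e = true) ∨
    ContainsCopy F' (E.filter fun e => χ e = false)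

/-- `H` is `(F,F')`-Ramsey with respect to `(𝓕,𝓕')`. -/
def RamseyWrt (E : Finset (Finset ℕ)) (F F' : H3) (𝓕 𝓕' : Finset (Finset ℕ)) : Prop :=
  ∀ χ : Finset ℕ → Bool,
    (∃ cV cE, IsCopy3 F cV cE ∧ cE ⊆ E.filter (fun e => χ e = true) ∧ cV ∉ 𝓕) ∨
    (∃ cV cE, IsCopy3 F' cV cE ∧ cE ⊆ E.filter (fun e => χ e = false) ∧ cV ∉ 𝓕')

/-- The complete bipartite graph between `X` and `Y`, as a set of pairs. -/
noncomputable def K2 (X Y : Finset ℕ) : Finset (Finset ℕ) :=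
  (X ×ˢ Y).image fun p => ({p.1, p.2} : Finset ℕ)

/-- `e_G(X,Y)` : the number of edges of `G` with one endpoint in `X` and one in `Y`. -/
noncomputable def e2 (G : Finset (Finset ℕ)) (X Y : Finset ℕ) : ℕ :=
  (G.filter fun e => ∃ x ∈ X, ∃ y ∈ Y, e = {x, y}).card

/-- The graph `G` is `(δ,d)`-regular between `X` and `Y`. -/
def BipRegular (δ d : ℝ) (G : Finset (Finset ℕ)) (X Y : Finset ℕ) : Prop :=
  ∀ X' ⊆ X, ∀ Y' ⊆ Y,
    |(e2 G X' Y' : ℝ) - d * X'.card * Y'.card| ≤ δ * X.card * Y.card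

/-- `e_H(X,Y,Z)` : the number of edges of the 3-graph `E` meeting `X`, `Y` and `Z`. -/
noncomputable def e3 (E : Finset (Finset ℕ)) (X Y Z : Finset ℕ) : ℕ :=
  (E.filter fun e => ∃ x ∈ X, ∃ y ∈ Y, ∃ z ∈ Z, e = {x, y, z}).card

/-- The 3-graph `E` is `(δ,d)`-weakly-regular on `(X,Y,Z)`. -/
def WeakRegularWith (δ d : ℝ) (E : Finset (Finset ℕ)) (X Y Z : Finset ℕ) : Prop :=
  ∀ X' ⊆ X, ∀ Y' ⊆ Y, ∀ Z' ⊆ Z,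
    |(e3 E X' Y' Z' : ℝ) - d * X'.card * Y'.card * Z'.card| ≤
      δ * X.card * Y.card * Z.card

/-- The 3-graph `E` is `δ`-weakly-regular on `(X,Y,Z)`. -/
def WeakRegular (δ : ℝ) (E : Finset (Finset ℕ)) (X Y Z : Finset ℕ) : Prop :=
  WeakRegularWith δ ((e3 E X Y Z : ℝ) / (X.card * Y.card * Z.card)) E X Y Z

/-- The 3-graph `E` is `δ`-weakly-regular with respect to the vertex partition `V`. -/
def WeakRegWrt (δ : ℝ) (E : Finset (Finset ℕ)) {t : ℕ} (V : Fin t → Finset ℕ) : Prop :=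
  let bad : Finset (Fin t × Fin t × Fin t) :=
    Finset.univ.filter fun x =>
      x.1 < x.2.1 ∧ x.2.1 < x.2.2 ∧ ¬ WeakRegular δ E (V x.1) (V x.2.1) (V x.2.2)
  (bad.card : ℝ) ≤ δ * (t.choose 3)

/-- `K_3(G)` on parts `(X,Y,Z)` : the triangles of `G` with one vertex in each part,
as a set of vertex triples. -/
noncomputable def triSets (G : Finset (Finset ℕ)) (X Y Z : Finset ℕ) : Finset (Finset ℕ) :=
  ((X ×ˢ Y ×ˢ Z).filter fun p =>
      ({p.1, p.2.1} : Finset ℕ) ∈ G ∧ ({p.1, p.2.2} : Finset ℕ) ∈ G ∧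
        ({p.2.1, p.2.2} : Finset ℕ) ∈ G).image fun p => ({p.1, p.2.1, p.2.2} : Finset ℕ)

/-- The relative density `d(E|P)` of a 3-graph `E` with respect to the tripartite
graph `P` on parts `(X,Y,Z)`. -/
noncomputable def relDen (E P : Finset (Finset ℕ)) (X Y Z : Finset ℕ) : ℝ :=
  ((E ∩ triSets P X Y Z).card : ℝ) / ((triSets P X Y Z).card : ℝ)

/-- The 3-graph `E` is `(δ,d,r)`-regular with respect to the tripartite graph `P`
on parts `(X,Y,Z)`. -/
def StrongRegular (δ d : ℝ) (r : ℕ) (E P : Finset (Finset ℕ)) (X Y Z : Finset ℕ) : Prop :=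
  ∀ Q : Fin r → Finset (Finset ℕ), (∀ i, Q i ⊆ P) →
    δ * ((triSets P X Y Z).card : ℝ)
        ≤ (((Finset.univ : Finset (Fin r)).biUnion fun i => triSets (Q i) X Y Z).card : ℝ) →
    0 < δ * ((triSets P X Y Z).card : ℝ) →
    |((E ∩ ((Finset.univ : Finset (Fin r)).biUnion fun i => triSets (Q i) X Y Z)).card : ℝ)
        - d * (((Finset.univ : Finset (Fin r)).biUnion fun i => triSets (Q i) X Y Z).card : ℝ)|
      ≤ δ * ((triSets P X Y Z).card : ℝ)

/-- The triad `B^{ijk}_{αβγ}` of a family of bipartite graphs. -/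
def triadG {t ℓ : ℕ} (B : Fin t → Fin t → Fin ℓ → Finset (Finset ℕ))
    (i j k : Fin t) (α β γ : Fin ℓ) : Finset (Finset ℕ) :=
  B i j α ∪ B i k β ∪ B j k γ

/-- The 3-graph `E` is `(δ,r)`-regular with respect to the partition `B` of the
pairs crossing the vertex partition `V` of `[n]`. -/
def StrongRegWrtB (δ : ℝ) (r : ℕ) (E : Finset (Finset ℕ)) {t ℓ : ℕ}
    (V : Fin t → Finset ℕ) (B : Fin t → Fin t → Fin ℓ → Finset (Finset ℕ)) (n : ℕ) : Prop :=
  let bad : Finset ((Fin t × Fin t × Fin t) × Fin ℓ × Fin ℓ × Fin ℓ) :=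
    Finset.univ.filter fun x =>
      x.1.1 < x.1.2.1 ∧ x.1.2.1 < x.1.2.2 ∧
        ¬ StrongRegular δ
          (relDen E (triadG B x.1.1 x.1.2.1 x.1.2.2 x.2.1 x.2.2.1 x.2.2.2)
            (V x.1.1) (V x.1.2.1) (V x.1.2.2))
          r E (triadG B x.1.1 x.1.2.1 x.1.2.2 x.2.1 x.2.2.1 x.2.2.2)
          (V x.1.1) (V x.1.2.1) (V x.1.2.2)
  ((bad.biUnion fun x =>
      triSets (triadG B x.1.1 x.1.2.1 x.1.2.2 x.2.1 x.2.2.1 x.2.2.2)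
        (V x.1.1) (V x.1.2.1) (V x.1.2.2)).card : ℝ) ≤ δ * (n : ℝ) ^ 3

/-- The joint link graph `⋂_{j} L_H(x_j, P)` of a tuple `x`, supported on the
bipartite part of `P` between `Y` and `Z`. -/
noncomputable def jointLink (EH P : Finset (Finset ℕ)) (Y Z : Finset ℕ) {t : ℕ}
    (x : Fin t → ℕ) : Finset (Finset ℕ) :=
  P.filter fun e => (∃ y ∈ Y, ∃ z ∈ Z, e = {y, z}) ∧ ∀ j : Fin t, insert (x j) e ∈ EH

/-- The joint link graph `L_H(X) = ⋂_{x ∈ X} L_H(x)` of a set `X` of vertices of a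
3-graph on `[n]`. -/
noncomputable def jointLinkSet (n : ℕ) (E : Finset (Finset ℕ)) (X : Finset ℕ) :
    Finset (Finset ℕ) :=
  ((Finset.range n).powersetCard 2).filter fun q => ∀ x ∈ X, insert x q ∈ E

/-- The complete tripartite 3-graph on parts `V1`, `V2`, `V3`. -/
noncomputable def tripartiteEdges (V1 V2 V3 : Finset ℕ) : Finset (Finset ℕ) :=
  (V1 ×ˢ V2 ×ˢ V3).image fun p => ({p.1, p.2.1, p.2.2} : Finset ℕ)

/-- The minimum 1-degree `δ₁` of a 3-graph on `[n]`. -/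
noncomputable def minDeg1 (n : ℕ) (E : Finset (Finset ℕ)) : ℕ :=
  if h : ((Finset.range n).image fun v => (E.filter fun e => v ∈ e).card).Nonempty then
    ((Finset.range n).image fun v => (E.filter fun e => v ∈ e).card).min' h
  else 0

/-- `(cV, cE)` is a copy of the graph `(KV, KE)` (an isomorphic image). -/
def IsCopy2 (KV : Finset ℕ) (KE : Finset (Finset ℕ))
    (cV : Finset ℕ) (cE : Finset (Finset ℕ)) : Prop :=
  ∃ φ : ℕ → ℕ, Set.InjOn φ ↑KV ∧ cV = KV.image φ ∧ cE = KE.image fun e => e.image φ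

/-- The average of `f` over the `c`-fibre of `ω` in `Ω`. -/
noncomputable def fibAvg {ι κ : Type*} (Ω : Finset ι) (c : ι → κ) (f : ι → ℝ) (ω : ι) : ℝ :=
  (∑ x ∈ Ω with c x = c ω, f x) / (#{x ∈ Ω | c x = c ω} : ℝ)

/-- The energy (mean square density) of `f` with respect to the colouring `c` of `Ω`. -/
noncomputable def energy {ι κ : Type*} (Ω : Finset ι) (c : ι → κ) (f : ι → ℝ) : ℝ :=
  ∑ ω ∈ Ω, fibAvg Ω c f ω ^ 2

section Energy

variable {ι κ κ' : Type*} {Ω : Finset ι} {c : ι → κ} {c' : ι → κ'} {f g : ι → ℝ}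

theorem sum_mul_fibAvg (hg : ∀ x ∈ Ω, ∀ y ∈ Ω, c x = c y → g x = g y) :
    ∑ ω ∈ Ω, fibAvg Ω c f ω * g ω = ∑ ω ∈ Ω, f ω * g ω := by
  have h1 : ∀ ω ∈ Ω, fibAvg Ω c f ω * g ω =
      ∑ x ∈ Ω, if c x = c ω then f x * g x / (#{y ∈ Ω | c y = c x} : ℝ) else 0 := by
    intro ω hω
    rw [fibAvg, ← Finset.sum_filter, div_mul_eq_mul_div, Finset.sum_mul, Finset.sum_div]
    refine Finset.sum_congr rfl fun x hx => ?_
    rw [Finset.mem_filter] at hx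
    rw [hg x hx.1 ω hω hx.2, hx.2]
  rw [Finset.sum_congr rfl h1, Finset.sum_comm]
  refine Finset.sum_congr rfl fun x hx => ?_
  have h2 : (#{y ∈ Ω | c y = c x} : ℝ) ≠ 0 := by
    have : x ∈ ({y ∈ Ω | c y = c x} : Finset ι) := by simp [hx]
    exact_mod_cast (Finset.card_pos.2 ⟨x, this⟩).ne'
  rw [← Finset.sum_filter, Finset.sum_const, nsmul_eq_mul]
  have h3 : (#{y ∈ Ω | c x = c y} : ℝ) = (#{y ∈ Ω | c y = c x} : ℝ) := by
    simp only [eq_comm]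
  rw [h3]
  field_simp

theorem fibAvg_congr {x y : ι} (h : c x = c y) : fibAvg Ω c f x = fibAvg Ω c f y := by
  simp only [fibAvg, h]

theorem sum_le_energy (hg : ∀ x ∈ Ω, ∀ y ∈ Ω, c x = c y → g x = g y) :
    ∑ ω ∈ Ω, (2 * (f ω * g ω) - g ω ^ 2) ≤ energy Ω c f := by
  rw [Finset.sum_sub_distrib, ← Finset.mul_sum, ← sum_mul_fibAvg hg, energy,
    Finset.mul_sum, ← Finset.sum_sub_distrib]
  refine Finset.sum_le_sum fun ω _ => ?_
  nlinarith [sq_nonneg (fibAvg Ω c f ω - g ω)]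

theorem energy_eq_sum_mul : energy Ω c f = ∑ ω ∈ Ω, f ω * fibAvg Ω c f ω := by
  rw [← sum_mul_fibAvg (c := c) fun x _ y _ h => fibAvg_congr h, energy]
  exact Finset.sum_congr rfl fun ω _ => sq _

theorem fibAvg_nonneg (hf : ∀ x, 0 ≤ f x) (ω : ι) : 0 ≤ fibAvg Ω c f ω :=
  div_nonneg (Finset.sum_nonneg fun x _ => hf x) (Nat.cast_nonneg _)

theorem fibAvg_le_one (hf : ∀ x, f x ≤ 1) (ω : ι) : fibAvg Ω c f ω ≤ 1 := by
  refine div_le_one_of_le₀ ?_ (Nat.cast_nonneg _)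
  calc _ ≤ ∑ x ∈ Ω with c x = c ω, (1 : ℝ) := Finset.sum_le_sum fun x _ => hf x
    _ = _ := by simp

theorem energy_nonneg : 0 ≤ energy Ω c f := Finset.sum_nonneg fun _ _ => sq_nonneg _

theorem energy_le_card (hf0 : ∀ x, 0 ≤ f x) (hf1 : ∀ x, f x ≤ 1) :
    energy Ω c f ≤ (#Ω : ℝ) := by
  calc _ ≤ ∑ x ∈ Ω, (1 : ℝ) := Finset.sum_le_sum fun x _ =>
        pow_le_one₀ (fibAvg_nonneg hf0 x) (fibAvg_le_one hf1 x)
    _ = _ := by simp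

/-- A colouring that refines `c` outside of a small exceptional set `Z` has almost as
much energy as `c`. -/
theorem energy_sub_le_of_refines (hf0 : ∀ x, 0 ≤ f x) (hf1 : ∀ x, f x ≤ 1) (Z : Finset ι)
    (hZ : Z ⊆ Ω)
    (h : ∀ x ∈ Ω, ∀ y ∈ Ω, c' x = c' y → (x ∈ Z ↔ y ∈ Z) ∧ (x ∉ Z → c x = c y)) :
    energy Ω c f - 2 * #Z ≤ energy Ω c' f := by
  refine le_trans ?_ (sum_le_energy (g := fun x => if x ∈ Z then 0 else fibAvg Ω c f x) ?_)
  · have h1 : (#Z : ℝ) = ∑ ω ∈ Ω, if ω ∈ Z then (1 : ℝ) else 0 := by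
      rw [Finset.sum_ite_mem, Finset.inter_eq_right.2 hZ]; simp
    have h2 : energy Ω c f = ∑ ω ∈ Ω, (2 * (f ω * fibAvg Ω c f ω) - fibAvg Ω c f ω ^ 2) := by
      rw [Finset.sum_sub_distrib, ← Finset.mul_sum, ← energy_eq_sum_mul]
      change _ = _ - energy Ω c f
      ring
    rw [h2, h1, Finset.mul_sum, ← Finset.sum_sub_distrib]
    refine Finset.sum_le_sum fun ω _ => ?_
    have a0 := fibAvg_nonneg (Ω := Ω) (c := c) hf0 ω
    have a1 := fibAvg_le_one (Ω := Ω) (c := c) hf1 ω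
    have b0 := hf0 ω
    have b1 := hf1 ω
    split_ifs
    · nlinarith
    · simp
  · intro x hx y hy hxy
    obtain ⟨h1, h2⟩ := h x hx y hy hxy
    by_cases hxZ : x ∈ Z
    · simp [hxZ, h1.1 hxZ]
    · have hyZ : y ∉ Z := fun hy => hxZ (h1.2 hy)
      simp only [hxZ, hyZ, if_false]
      exact fibAvg_congr (h2 hxZ)

theorem energy_mono_of_refines (hf0 : ∀ x, 0 ≤ f x) (hf1 : ∀ x, f x ≤ 1)
    (h : ∀ x ∈ Ω, ∀ y ∈ Ω, c' x = c' y → c x = c y) :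
    energy Ω c f ≤ energy Ω c' f := by
  have := energy_sub_le_of_refines (c := c) (c' := c') hf0 hf1 ∅ (Finset.empty_subset Ω)
    fun x hx y hy hxy => ⟨by simp, fun _ => h x hx y hy hxy⟩
  simpa using this

/-- Refining a colouring by a set on which `f` deviates from its fibre averages increases
the energy. -/
theorem energy_add_le_of_witness {δ : ℝ} (hδ : 0 ≤ δ) (bad : Finset κ) (W : κ → Finset ι)
    (hW : ∀ k ∈ bad, W k ⊆ {x ∈ Ω | c x = k})
    (hdev : ∀ k ∈ bad, δ * (#{x ∈ Ω | c x = k} : ℝ) ≤ |∑ x ∈ W k, (f x - fibAvg Ω c f x)|)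
    (h : ∀ x ∈ Ω, ∀ y ∈ Ω, c' x = c' y → c x = c y ∧ (x ∈ W (c x) ↔ y ∈ W (c x))) :
    energy Ω c f + δ ^ 2 * ∑ k ∈ bad, (#{x ∈ Ω | c x = k} : ℝ) ≤ energy Ω c' f := by
  classical
  set σ : κ → ℝ := fun k => if 0 ≤ ∑ x ∈ W k, (f x - fibAvg Ω c f x) then δ else -δ with hσ
  set p : ι → ℝ := fun x => if c x ∈ bad ∧ x ∈ W (c x) then σ (c x) else 0 with hp
  have hp_sum : ∀ F : ι → ℝ, ∑ x ∈ Ω, F x * p x = ∑ k ∈ bad, σ k * ∑ x ∈ W k, F x := by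
    intro F
    have h1 : ∀ x ∈ Ω, F x * p x = ∑ k ∈ bad, if x ∈ W k then σ k * F x else 0 := by
      intro x hx
      by_cases hb : c x ∈ bad
      · rw [Finset.sum_eq_single_of_mem (c x) hb]
        · simp only [hp, hb, true_and]; split_ifs <;> ring
        · intro k hk hne
          rw [if_neg]
          intro hxk
          exact hne (Finset.mem_filter.1 (hW k hk hxk)).2.symm
      · rw [Finset.sum_eq_zero]
        · simp [hp, hb]
        · intro k hk
          rw [if_neg]
          intro hxk
          exact hb ((Finset.mem_filter.1 (hW k hk hxk)).2 ▸ hk)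
    rw [Finset.sum_congr rfl h1, Finset.sum_comm]
    refine Finset.sum_congr rfl fun k hk => ?_
    rw [Finset.sum_ite_mem, Finset.mul_sum, Finset.inter_eq_right.2]
    exact (hW k hk).trans (Finset.filter_subset _ _)
  refine le_trans ?_ (sum_le_energy (g := fun x => fibAvg Ω c f x + p x) ?_)
  · have hsq : ∀ k, σ k * σ k = δ ^ 2 := by
      intro k; simp only [hσ]; split_ifs <;> ring
    have h2 : ∑ x ∈ Ω, (2 * (f x * (fibAvg Ω c f x + p x)) - (fibAvg Ω c f x + p x) ^ 2) =
        energy Ω c f + (2 * ∑ x ∈ Ω, (f x - fibAvg Ω c f x) * p x - ∑ x ∈ Ω, p x * p x) := by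
      have h3 := energy_eq_sum_mul (Ω := Ω) (c := c) (f := f)
      have h4 : energy Ω c f = ∑ ω ∈ Ω, fibAvg Ω c f ω ^ 2 := rfl
      have h5 : energy Ω c f = 2 * energy Ω c f - energy Ω c f := by ring
      rw [h5]
      nth_rewrite 1 [h3]
      rw [h4, Finset.mul_sum, Finset.mul_sum, ← Finset.sum_sub_distrib, ← Finset.sum_sub_distrib,
        ← Finset.sum_add_distrib]
      exact Finset.sum_congr rfl fun x _ => by ring
    rw [h2, hp_sum, hp_sum, Finset.mul_sum, Finset.mul_sum, ← Finset.sum_sub_distrib]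
    gcongr with k hk
    have hpk : ∑ x ∈ W k, p x = σ k * #(W k) := by
      rw [Finset.sum_congr rfl (g := fun _ => σ k), Finset.sum_const, nsmul_eq_mul, mul_comm]
      intro x hx
      have hc := (Finset.mem_filter.1 (hW k hk hx)).2
      simp only [hp, hc, hk, hx, true_and, if_true]
    have hcard : (#(W k) : ℝ) ≤ #{x ∈ Ω | c x = k} := by
      exact_mod_cast Finset.card_le_card (hW k hk)
    have habs : σ k * ∑ x ∈ W k, (f x - fibAvg Ω c f x) =
        δ * |∑ x ∈ W k, (f x - fibAvg Ω c f x)| := by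
      simp only [hσ]
      split_ifs with h0
      · rw [abs_of_nonneg h0]
      · rw [abs_of_neg (not_le.1 h0)]; ring
    have hpk2 : σ k * (σ k * (#(W k) : ℝ)) = δ ^ 2 * #(W k) := by rw [← mul_assoc, hsq]
    rw [hpk, habs, hpk2]
    nlinarith [hdev k hk, mul_le_mul_of_nonneg_left (hdev k hk) hδ,
      mul_le_mul_of_nonneg_left hcard (sq_nonneg δ)]
  · intro x hx y hy hxy
    obtain ⟨h1, h2⟩ := h x hx y hy hxy
    have h3 : p x = p y := by
      simp only [hp, ← h1, h2]
    simp only [h3, fibAvg_congr (Ω := Ω) (f := f) h1]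

end Energy

/-- If every object of bounded complexity `C` and energy `q` either is successful or yields an
object of bounded complexity and energy `q + η`, then every large object is successful. -/
theorem energy_iteration {O : Type*} (size : O → ℕ) (Succ : ℕ → O → Prop)
    (hmono : ∀ T T' o, T ≤ T' → Succ T o → Succ T' o) (Q : ℕ → ℝ → O → Prop) {η M : ℝ}
    (hη : 0 < η) (C₀ : ℕ) (n₁ T₁ : ℕ) (h0 : ∀ o, n₁ ≤ size o → Succ T₁ o ∨ Q C₀ 0 o)
    (hstep : ∀ C, ∃ C' T n₀, ∀ o, n₀ ≤ size o → ∀ q, Q C q o → Succ T o ∨ Q C' (q + η) o)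
    (hbound : ∀ C q o, Q C q o → q ≤ M) :
    ∃ T n₀, ∀ o, n₀ ≤ size o → Succ T o := by
  have key : ∀ k : ℕ, ∃ C T n₀, ∀ o, n₀ ≤ size o → Succ T o ∨ Q C (k * η) o := by
    intro k
    induction k with
    | zero => exact ⟨C₀, T₁, n₁, by simpa using h0⟩
    | succ k ih =>
      obtain ⟨C, T, n₀, h⟩ := ih
      obtain ⟨C', T', n₀', h'⟩ := hstep C
      refine ⟨C', max T T', max n₀ n₀', fun o ho => ?_⟩
      rcases h o ((le_max_left _ _).trans ho) with h1 | h1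
      · exact Or.inl (hmono _ _ _ (le_max_left _ _) h1)
      · rcases h' o ((le_max_right _ _).trans ho) _ h1 with h2 | h2
        · exact Or.inl (hmono _ _ _ (le_max_right _ _) h2)
        · refine Or.inr ?_
          have : ((k + 1 : ℕ) : ℝ) * η = k * η + η := by push_cast; ring
          rwa [this]
  obtain ⟨k, hk⟩ := exists_nat_gt (M / η)
  obtain ⟨C, T, n₀, h⟩ := key k
  refine ⟨T, n₀, fun o ho => (h o ho).resolve_right fun hq => ?_⟩
  have := hbound _ _ _ hq
  rw [div_lt_iff₀ hη] at hk
  linarith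

/-- `V` is an equitable partition of `range n` with parts sorted by size. -/
structure EquiPart (n t : ℕ) (V : Fin t → Finset ℕ) : Prop where
  cover : (Finset.univ : Finset (Fin t)).biUnion V = Finset.range n
  disj : ∀ i j : Fin t, i ≠ j → Disjoint (V i) (V j)
  sorted : ∀ i j : Fin t, i ≤ j → (V i).card ≤ (V j).card
  near : ∀ i j : Fin t, (V j).card ≤ (V i).card + 1

namespace EquiPart

variable {n t : ℕ} {V : Fin t → Finset ℕ}

theorem subset_range (h : EquiPart n t V) (i : Fin t) : V i ⊆ range n := by
  rw [← h.cover]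
  exact Finset.subset_biUnion_of_mem V (Finset.mem_univ i)

theorem eq_of_mem (h : EquiPart n t V) {i j : Fin t} {x : ℕ} (hi : x ∈ V i) (hj : x ∈ V j) :
    i = j := by
  by_contra hne
  exact Finset.disjoint_left.1 (h.disj i j hne) hi hj

theorem sum_card (h : EquiPart n t V) : ∑ i, #(V i) = n := by
  rw [← Finset.card_biUnion fun i _ j _ hij => h.disj i j hij, h.cover, Finset.card_range]

theorem exists_label (h : EquiPart n t V) (ht : 0 < t) :
    ∃ lab : ℕ → Fin t, ∀ x ∈ range n, x ∈ V (lab x) := by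
  have : ∀ x, ∃ i : Fin t, x ∈ range n → x ∈ V i := by
    intro x
    by_cases hx : x ∈ range n
    · have hx' := hx
      rw [← h.cover, Finset.mem_biUnion] at hx'
      obtain ⟨i, _, hi⟩ := hx'
      exact ⟨i, fun _ => hi⟩
    · exact ⟨⟨0, ht⟩, fun h => absurd h hx⟩
  choose lab hlab using this
  exact ⟨lab, hlab⟩

theorem card_le (h : EquiPart n t V) (i : Fin t) : (#(V i) : ℝ) * t ≤ n + t := by
  have h1 : ∑ j : Fin t, #(V i) ≤ ∑ j, (#(V j) + 1) := Finset.sum_le_sum fun j _ => h.near j i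
  rw [Finset.sum_add_distrib, h.sum_card] at h1
  simp only [Finset.sum_const, Finset.card_univ, Fintype.card_fin, smul_eq_mul, mul_one] at h1
  have h2 : t * #(V i) ≤ n + t := h1
  have h3 : (t : ℝ) * #(V i) ≤ n + t := by exact_mod_cast h2
  linarith

theorem le_card (h : EquiPart n t V) (i : Fin t) : (n : ℝ) ≤ (#(V i) + 1) * t := by
  have h1 : ∑ j, #(V j) ≤ ∑ j : Fin t, (#(V i) + 1) := Finset.sum_le_sum fun j _ => h.near i j
  rw [h.sum_card] at h1
  simp only [Finset.sum_const, Finset.card_univ, Fintype.card_fin, smul_eq_mul] at h1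
  have h3 : (n : ℝ) ≤ t * (#(V i) + 1) := by exact_mod_cast h1
  linarith

theorem half_le_card (h : EquiPart n t V) (ht : 0 < t) (hn : 2 * t ≤ n) (i : Fin t) :
    (n : ℝ) / (2 * t) ≤ #(V i) := by
  have h1 := h.le_card i
  have h2 : (2 * t : ℝ) ≤ n := by exact_mod_cast hn
  have h3 : (0 : ℝ) < t := by exact_mod_cast ht
  rw [div_le_iff₀ (by positivity)]
  nlinarith

end EquiPart

/-- Every vertex colouring is refined, up to few vertices, by an equitable partition. -/
theorem exists_equiPart {C t n : ℕ} (v : ℕ → Fin C) (ht : 0 < t) (htn : t ≤ n) :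
    ∃ V : Fin t → Finset ℕ, EquiPart n t V ∧ ∃ Z ⊆ range n, #Z ≤ C * (n / t) ∧
      ∀ i, ∀ x ∈ V i, ∀ y ∈ V i, (x ∈ Z ↔ y ∈ Z) ∧ (x ∉ Z → v x = v y) := by
  set parts : Finset (Finset ℕ) :=
    ((Finset.univ : Finset (Fin C)).image fun k => {x ∈ range n | v x = k}).erase ∅ with hparts
  have hm : 0 < n / t := Nat.div_pos htn ht
  let P : Finpartition (range n) := Finpartition.ofExistsUnique parts
    (by
      intro p hp
      obtain ⟨k, _, rfl⟩ := Finset.mem_image.1 (Finset.mem_of_mem_erase hp)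
      exact Finset.filter_subset _ _)
    (by
      intro a ha
      refine ⟨{x ∈ range n | v x = v a}, ⟨Finset.mem_erase.2 ⟨?_, ?_⟩, ?_⟩, ?_⟩
      · exact Finset.ne_empty_of_mem (a := a) (by simpa using ha)
      · exact Finset.mem_image_of_mem _ (Finset.mem_univ _)
      · simpa using ha
      · rintro p ⟨hp, hap⟩
        obtain ⟨k, _, rfl⟩ := Finset.mem_image.1 (Finset.mem_of_mem_erase hp)
        rw [(Finset.mem_filter.1 hap).2])
    (Finset.notMem_erase _ _)
  have hPparts : P.parts = parts := rfl
  have hsum : (t - n % t) * (n / t) + n % t * (n / t + 1) = #(range n) := by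
    rw [Finset.card_range, tsub_mul, mul_add, ← add_assoc,
      tsub_add_cancel_of_le (Nat.mul_le_mul_right _ (Nat.mod_lt _ ht).le), mul_one, add_comm,
      Nat.mod_add_div]
  set R := P.equitabilise hsum with hR
  have hRcard : #R.parts = t := by
    rw [hR, Finpartition.card_parts_equitabilise _ _ hm.ne',
      tsub_add_cancel_of_le (Nat.mod_lt _ ht).le]
  let e : Fin t ≃ R.parts := (finCongr hRcard.symm).trans R.parts.equivFin.symm
  let F : Fin t → ℕ := fun i => #((e i : Finset ℕ))
  let V : Fin t → Finset ℕ := fun i => (e (Tuple.sort F i) : Finset ℕ)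
  have hVmem : ∀ i, V i ∈ R.parts := fun i => (e (Tuple.sort F i)).2
  have hVinj : ∀ i j, V i = V j → i = j := by
    intro i j hij
    exact (Tuple.sort F).injective (e.injective (Subtype.ext hij))
  have hVsurj : ∀ p ∈ R.parts, ∃ i, V i = p := by
    intro p hp
    refine ⟨(Tuple.sort F).symm (e.symm ⟨p, hp⟩), ?_⟩
    simp [V]
  have hEq : EquiPart n t V := by
    refine ⟨?_, ?_, ?_, ?_⟩
    · ext x
      constructor
      · intro hx
        obtain ⟨i, _, hi⟩ := Finset.mem_biUnion.1 hx
        exact R.le (hVmem i) hi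
      · intro hx
        obtain ⟨p, hp, hxp⟩ := R.exists_mem hx
        obtain ⟨i, rfl⟩ := hVsurj p hp
        exact Finset.mem_biUnion.2 ⟨i, Finset.mem_univ _, hxp⟩
    · intro i j hij
      exact R.disjoint (hVmem i) (hVmem j) fun h => hij (hVinj i j h)
    · intro i j hij
      exact Tuple.monotone_sort F hij
    · intro i j
      have hi := Finpartition.card_eq_of_mem_parts_equitabilise (hVmem i)
      have hj := Finpartition.card_eq_of_mem_parts_equitabilise (hVmem j)
      omega
  refine ⟨V, hEq, (P.parts.biUnion fun u => u \ ({p ∈ R.parts | p ⊆ u}).biUnion id), ?_, ?_, ?_⟩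
  · intro x hx
    obtain ⟨u, hu, hxu⟩ := Finset.mem_biUnion.1 hx
    exact P.le hu (Finset.mem_sdiff.1 hxu).1
  · calc _ ≤ ∑ u ∈ P.parts, #(u \ ({p ∈ R.parts | p ⊆ u}).biUnion id) := Finset.card_biUnion_le
      _ ≤ ∑ u ∈ P.parts, n / t := Finset.sum_le_sum fun u hu => by
          have := P.card_parts_equitabilise_subset_le hsum hu
          convert this
      _ = #P.parts * (n / t) := by rw [Finset.sum_const, smul_eq_mul]
      _ ≤ C * (n / t) := by
          refine Nat.mul_le_mul_right _ ?_
          rw [hPparts]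
          exact (Finset.card_erase_le.trans Finset.card_image_le).trans (by simp)
  · have hmono : ∀ i, ∀ x ∈ V i,
        x ∉ (P.parts.biUnion fun u => u \ ({p ∈ R.parts | p ⊆ u}).biUnion id) →
          ∃ k, ∀ y ∈ V i, v y = k := by
      intro i x hx hxZ
      obtain ⟨u, hu, hxu⟩ := P.exists_mem (R.le (hVmem i) hx)
      have hxU : x ∈ ({p ∈ R.parts | p ⊆ u}).biUnion id := by
        by_contra hcon
        exact hxZ (Finset.mem_biUnion.2 ⟨u, hu, Finset.mem_sdiff.2 ⟨hxu, hcon⟩⟩)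
      obtain ⟨p, hp, hxp⟩ := Finset.mem_biUnion.1 hxU
      obtain ⟨hpR, hpu⟩ := Finset.mem_filter.1 hp
      have hpV : p = V i := R.eq_of_mem_parts hpR (hVmem i) hxp hx
      obtain ⟨k, _, rfl⟩ := Finset.mem_image.1 (Finset.mem_of_mem_erase hu)
      exact ⟨k, fun y hy => (Finset.mem_filter.1 (hpu (hpV ▸ hy))).2⟩
    have hstay : ∀ i, ∀ x ∈ V i, ∀ y ∈ V i,
        x ∉ (P.parts.biUnion fun u => u \ ({p ∈ R.parts | p ⊆ u}).biUnion id) →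
        y ∉ (P.parts.biUnion fun u => u \ ({p ∈ R.parts | p ⊆ u}).biUnion id) := by
      intro i x hx y hy hxZ hyZ
      obtain ⟨k, hk⟩ := hmono i x hx hxZ
      obtain ⟨u, hu, hyu⟩ := Finset.mem_biUnion.1 hyZ
      obtain ⟨hyu, hyn⟩ := Finset.mem_sdiff.1 hyu
      refine hyn (Finset.mem_biUnion.2 ⟨V i, Finset.mem_filter.2 ⟨hVmem i, fun z hz => ?_⟩, hy⟩)
      obtain ⟨k', _, rfl⟩ := Finset.mem_image.1 (Finset.mem_of_mem_erase hu)
      rw [Finset.mem_filter] at hyu ⊢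
      exact ⟨R.le (hVmem i) hz, by rw [hk z hz, ← hk y hy, hyu.2]⟩
    intro i x hx y hy
    refine ⟨not_iff_not.1 ⟨hstay i x hx y hy, hstay i y hy x hx⟩, fun hxZ => ?_⟩
    obtain ⟨k, hk⟩ := hmono i x hx hxZ
    rw [hk x hx, hk y hy]

/-- All ordered triples of elements of `range n`. -/
def cube (n : ℕ) : Finset (ℕ × ℕ × ℕ) := range n ×ˢ range n ×ˢ range n

theorem card_cube (n : ℕ) : (#(cube n) : ℝ) = (n : ℝ) ^ 3 := by
  simp only [cube, Finset.card_product, Finset.card_range]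
  push_cast
  ring

theorem mem_cube {n : ℕ} {x : ℕ × ℕ × ℕ} :
    x ∈ cube n ↔ x.1 ∈ range n ∧ x.2.1 ∈ range n ∧ x.2.2 ∈ range n := by
  simp only [cube, Finset.mem_product]

/-- Weak regularity of a function of three variables on a triple of vertex sets. -/
def TriReg (ε : ℝ) (f : ℕ × ℕ × ℕ → ℝ) (X Y Z : Finset ℕ) : Prop :=
  ∀ X' ⊆ X, ∀ Y' ⊆ Y, ∀ Z' ⊆ Z,
    |∑ x ∈ X' ×ˢ Y' ×ˢ Z', f x -
      (∑ x ∈ X ×ˢ Y ×ˢ Z, f x) / #(X ×ˢ Y ×ˢ Z) * #(X' ×ˢ Y' ×ˢ Z')| ≤ ε * #(X ×ˢ Y ×ˢ Z)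

/-- The colouring of triples induced by a vertex colouring. -/
def vertCol {κ : Type*} (v : ℕ → κ) (x : ℕ × ℕ × ℕ) : κ × κ × κ := (v x.1, v x.2.1, v x.2.2)

theorem card_cube_filter_mem_le (n : ℕ) (Z : Finset ℕ) :
    #{x ∈ cube n | x.1 ∈ Z ∨ x.2.1 ∈ Z ∨ x.2.2 ∈ Z} ≤ 3 * (#Z * n ^ 2) := by
  have : {x ∈ cube n | x.1 ∈ Z ∨ x.2.1 ∈ Z ∨ x.2.2 ∈ Z} ⊆
      (Z ×ˢ range n ×ˢ range n) ∪ (range n ×ˢ Z ×ˢ range n) ∪ (range n ×ˢ range n ×ˢ Z) := by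
    intro x hx
    simp only [Finset.mem_filter, mem_cube] at hx
    simp only [Finset.mem_union, Finset.mem_product]
    tauto
  refine (Finset.card_le_card this).trans ?_
  refine (Finset.card_union_le _ _).trans ?_
  refine (Nat.add_le_add_right (Finset.card_union_le _ _) _).trans ?_
  simp only [Finset.card_product, Finset.card_range]
  apply le_of_eq
  ring

theorem energy_vertCol_sub_le {κ κ' : Type*} {n : ℕ} {f : ℕ × ℕ × ℕ → ℝ} (hf0 : ∀ x, 0 ≤ f x)
    (hf1 : ∀ x, f x ≤ 1) (v : ℕ → κ) (v' : ℕ → κ') {Z : Finset ℕ}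
    (h : ∀ x ∈ range n, ∀ y ∈ range n, v' x = v' y → (x ∈ Z ↔ y ∈ Z) ∧ (x ∉ Z → v x = v y)) :
    energy (cube n) (vertCol v) f - 6 * (#Z * n ^ 2) ≤ energy (cube n) (vertCol v') f := by
  refine le_trans ?_ (energy_sub_le_of_refines (c := vertCol v) hf0 hf1
    {x ∈ cube n | x.1 ∈ Z ∨ x.2.1 ∈ Z ∨ x.2.2 ∈ Z} (Finset.filter_subset _ _) ?_)
  · have h1 : (#{x ∈ cube n | x.1 ∈ Z ∨ x.2.1 ∈ Z ∨ x.2.2 ∈ Z} : ℝ) ≤ 3 * (#Z * n ^ 2) := by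
      exact_mod_cast card_cube_filter_mem_le n Z
    linarith
  · intro x hx y hy hxy
    simp only [vertCol, Prod.mk.injEq] at hxy
    have hx' := mem_cube.1 hx
    have hy' := mem_cube.1 hy
    obtain ⟨a1, a2⟩ := h _ hx'.1 _ hy'.1 hxy.1
    obtain ⟨b1, b2⟩ := h _ hx'.2.1 _ hy'.2.1 hxy.2.1
    obtain ⟨c1, c2⟩ := h _ hx'.2.2 _ hy'.2.2 hxy.2.2
    refine ⟨by simp only [Finset.mem_filter, hx, hy, a1, b1, c1], fun hn => ?_⟩
    simp only [Finset.mem_filter, hx, true_and, not_or] at hn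
    simp only [vertCol, a2 hn.1, b2 hn.2.1, c2 hn.2.2]

section Gain

variable {n t : ℕ} {V : Fin t → Finset ℕ} {lab : ℕ → Fin t}

theorem EquiPart.mem_iff_label (hV : EquiPart n t V) (hlab : ∀ x ∈ range n, x ∈ V (lab x))
    {i : Fin t} {x : ℕ} : x ∈ V i ↔ x ∈ range n ∧ lab x = i :=
  ⟨fun h => ⟨hV.subset_range i h, hV.eq_of_mem (hlab x (hV.subset_range i h)) h⟩,
    fun h => h.2 ▸ hlab x h.1⟩

theorem vertCol_fibre (hV : EquiPart n t V) (hlab : ∀ x ∈ range n, x ∈ V (lab x))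
    (k : Fin t × Fin t × Fin t) [DecidablePred fun x => vertCol lab x = k] :
    {x ∈ cube n | vertCol lab x = k} = V k.1 ×ˢ V k.2.1 ×ˢ V k.2.2 := by
  ext x
  obtain ⟨i, j, l⟩ := k
  simp only [Finset.mem_filter, mem_cube, vertCol, Prod.mk.injEq, Finset.mem_product,
    hV.mem_iff_label hlab]
  tauto

theorem exists_energy_gain {A : Type*} [Fintype A] {ε : ℝ} (hε : 0 < ε) (hV : EquiPart n t V)
    (hlab : ∀ x ∈ range n, x ∈ V (lab x)) (f : A → ℕ × ℕ × ℕ → ℝ) :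
    ∃ v' : ℕ → Fin t × (A × Fin t × Fin t × Fin t → Prop × Prop × Prop),
      ∑ a, energy (cube n) (vertCol lab) (f a) +
        ε ^ 2 * ∑ k : Fin t × Fin t × Fin t with
            ∃ a, ¬ TriReg ε (f a) (V k.1) (V k.2.1) (V k.2.2),
          (#(V k.1 ×ˢ V k.2.1 ×ˢ V k.2.2) : ℝ) ≤
      ∑ a, energy (cube n) (vertCol v') (f a) := by
  have hw : ∀ q : A × Fin t × Fin t × Fin t, ∃ W : Finset ℕ × Finset ℕ × Finset ℕ,
      ¬ TriReg ε (f q.1) (V q.2.1) (V q.2.2.1) (V q.2.2.2) →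
      W.1 ⊆ V q.2.1 ∧ W.2.1 ⊆ V q.2.2.1 ∧ W.2.2 ⊆ V q.2.2.2 ∧
      ε * #(V q.2.1 ×ˢ V q.2.2.1 ×ˢ V q.2.2.2) < |∑ x ∈ W.1 ×ˢ W.2.1 ×ˢ W.2.2, f q.1 x -
        (∑ x ∈ V q.2.1 ×ˢ V q.2.2.1 ×ˢ V q.2.2.2, f q.1 x) /
          #(V q.2.1 ×ˢ V q.2.2.1 ×ˢ V q.2.2.2) * #(W.1 ×ˢ W.2.1 ×ˢ W.2.2)| := by
    intro q
    by_cases h : TriReg ε (f q.1) (V q.2.1) (V q.2.2.1) (V q.2.2.2)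
    · exact ⟨default, fun h' => absurd h h'⟩
    · have h' := h
      simp only [TriReg, not_forall, not_le] at h'
      obtain ⟨X, hX, Y, hY, Z, hZ, hdev⟩ := h'
      exact ⟨(X, Y, Z), fun _ => ⟨hX, hY, hZ, hdev⟩⟩
  choose W hW using hw
  refine ⟨fun x => (lab x, fun q => (x ∈ (W q).1, x ∈ (W q).2.1, x ∈ (W q).2.2)), ?_⟩
  have hsum : ∑ k : Fin t × Fin t × Fin t with
            ∃ a, ¬ TriReg ε (f a) (V k.1) (V k.2.1) (V k.2.2),
          (#(V k.1 ×ˢ V k.2.1 ×ˢ V k.2.2) : ℝ) ≤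
      ∑ a, ∑ k : Fin t × Fin t × Fin t with ¬ TriReg ε (f a) (V k.1) (V k.2.1) (V k.2.2),
          (#(V k.1 ×ˢ V k.2.1 ×ˢ V k.2.2) : ℝ) := by
    simp only [Finset.sum_filter]
    rw [Finset.sum_comm]
    refine Finset.sum_le_sum fun k _ => ?_
    split_ifs with h
    · obtain ⟨a, ha⟩ := h
      refine le_trans ?_ (Finset.single_le_sum (fun b _ => ?_) (Finset.mem_univ a))
      · rw [if_pos ha]
      · split_ifs <;> positivity
    · exact Finset.sum_nonneg fun b _ => by split_ifs <;> positivity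
  refine (add_le_add_right (mul_le_mul_of_nonneg_left hsum (sq_nonneg ε)) _).trans ?_
  rw [Finset.mul_sum, ← Finset.sum_add_distrib]
  refine Finset.sum_le_sum fun a _ => ?_
  have key := energy_add_le_of_witness (Ω := cube n) (c := vertCol lab)
    (c' := vertCol fun x => (lab x, fun q : A × Fin t × Fin t × Fin t =>
      (x ∈ (W q).1, x ∈ (W q).2.1, x ∈ (W q).2.2))) (f := f a) hε.le
    {k : Fin t × Fin t × Fin t | ¬ TriReg ε (f a) (V k.1) (V k.2.1) (V k.2.2)}
    (fun k => if TriReg ε (f a) (V k.1) (V k.2.1) (V k.2.2) then ∅ else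
      (W (a, k)).1 ×ˢ (W (a, k)).2.1 ×ˢ (W (a, k)).2.2) ?_ ?_ ?_
  · simpa only [vertCol_fibre hV hlab] using key
  · intro k hk
    have hk' := (Finset.mem_filter.1 hk).2
    obtain ⟨h1, h2, h3, -⟩ := hW (a, k) hk'
    rw [if_neg hk', vertCol_fibre hV hlab]
    exact Finset.product_subset_product h1 (Finset.product_subset_product h2 h3)
  · intro k hk
    have hk' := (Finset.mem_filter.1 hk).2
    obtain ⟨h1, h2, h3, h4⟩ := hW (a, k) hk'
    rw [if_neg hk', vertCol_fibre hV hlab]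
    refine h4.le.trans (le_of_eq ?_)
    congr 1
    have hconst : ∀ x ∈ (W (a, k)).1 ×ˢ (W (a, k)).2.1 ×ˢ (W (a, k)).2.2,
        fibAvg (cube n) (vertCol lab) (f a) x = (∑ x ∈ V k.1 ×ˢ V k.2.1 ×ˢ V k.2.2, f a x) /
          #(V k.1 ×ˢ V k.2.1 ×ˢ V k.2.2) := by
      intro x hx
      have hx' : x ∈ V k.1 ×ˢ V k.2.1 ×ˢ V k.2.2 :=
        (Finset.product_subset_product h1 (Finset.product_subset_product h2 h3)) hx
      rw [← vertCol_fibre hV hlab k, Finset.mem_filter] at hx'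
      rw [fibAvg, hx'.2, vertCol_fibre hV hlab]
    rw [Finset.sum_sub_distrib, Finset.sum_congr rfl hconst, Finset.sum_const, nsmul_eq_mul,
      mul_comm (#((W (a, k)).1 ×ˢ (W (a, k)).2.1 ×ˢ (W (a, k)).2.2) : ℝ)]
  · intro x hx y hy hxy
    simp only [vertCol, Prod.mk.injEq] at hxy
    obtain ⟨⟨a1, a2⟩, ⟨b1, b2⟩, c1, c2⟩ := hxy
    refine ⟨by simp only [vertCol, a1, b1, c1], ?_⟩
    split_ifs
    · simp
    · simp only [Finset.mem_product]
      have a3 := congrFun a2 (a, vertCol lab x)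
      have b3 := congrFun b2 (a, vertCol lab x)
      have c3 := congrFun c2 (a, vertCol lab x)
      simp only [Prod.mk.injEq] at a3 b3 c3
      rw [a3.1, b3.2.1, c3.2.2]

end Gain

theorem weak_regularity_step {A : Type} [Fintype A] {ε : ℝ} (hε : 0 < ε) (t₀ C : ℕ) :
    ∃ C' T n₀ : ℕ, ∀ n, n₀ ≤ n → ∀ f : A → ℕ × ℕ × ℕ → ℝ, (∀ a x, 0 ≤ f a x) →
      (∀ a x, f a x ≤ 1) → ∀ v : ℕ → Fin C, ∀ q : ℝ,
      q * n ^ 3 ≤ ∑ a, energy (cube n) (vertCol v) (f a) →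
      (∃ t V, t₀ ≤ t ∧ t ≤ T ∧ EquiPart n t V ∧
        (#{k : Fin t × Fin t × Fin t | ∃ a, ¬ TriReg ε (f a) (V k.1) (V k.2.1) (V k.2.2)} : ℝ)
          ≤ ε * t ^ 3) ∨
      ∃ v' : ℕ → Fin C',
        (q + ε ^ 3 / 16) * n ^ 3 ≤ ∑ a, energy (cube n) (vertCol v') (f a) := by
  obtain ⟨t₁, ht₁⟩ := exists_nat_gt (96 * Fintype.card A * C / ε ^ 3)
  set t := max (max t₀ 1) t₁ with ht
  have ht0 : t₀ ≤ t := (le_max_left _ _).trans (le_max_left _ _)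
  have htpos : 0 < t := (le_max_right t₀ 1).trans (le_max_left _ _)
  have htbig : 96 * Fintype.card A * C ≤ ε ^ 3 * t := by
    have : (t₁ : ℝ) ≤ t := by exact_mod_cast le_max_right _ _
    rw [div_lt_iff₀ (by positivity)] at ht₁
    nlinarith [pow_pos hε 3]
  refine ⟨Fintype.card (Fin t × (A × Fin t × Fin t × Fin t → Prop × Prop × Prop)), t, 2 * t,
    fun n hn f hf0 hf1 v q hq => ?_⟩
  obtain ⟨V, hV, Z, hZn, hZc, hZ⟩ := exists_equiPart v htpos (by omega : t ≤ n)
  by_cases hbad : (#{k : Fin t × Fin t × Fin t | ∃ a, ¬ TriReg ε (f a) (V k.1) (V k.2.1) (V k.2.2)}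
      : ℝ) ≤ ε * t ^ 3
  · exact Or.inl ⟨t, V, ht0, le_rfl, hV, hbad⟩
  right
  push Not at hbad
  obtain ⟨lab, hlab⟩ := hV.exists_label htpos
  obtain ⟨v', hv'⟩ := exists_energy_gain hε hV hlab f
  refine ⟨fun x => Fintype.equivFin _ (v' x), ?_⟩
  have h1 : ∑ a, energy (cube n) (vertCol v') (f a) ≤
      ∑ a, energy (cube n) (vertCol fun x => Fintype.equivFin _ (v' x)) (f a) := by
    refine Finset.sum_le_sum fun a _ => energy_mono_of_refines (hf0 a) (hf1 a) ?_
    intro x _ y _ hxy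
    simpa [vertCol] using hxy
  refine le_trans ?_ (hv'.trans h1)
  have hZr : (#Z : ℝ) * t ≤ C * n := by
    have : #Z * t ≤ C * n := by
      calc _ ≤ C * (n / t) * t := Nat.mul_le_mul_right _ hZc
        _ = C * (n / t * t) := by ring
        _ ≤ C * n := Nat.mul_le_mul_left _ (Nat.div_mul_le_self n t)
    exact_mod_cast this
  have h2 : ∑ a, energy (cube n) (vertCol v) (f a) - Fintype.card A * (6 * (#Z * n ^ 2)) ≤
      ∑ a, energy (cube n) (vertCol lab) (f a) := by
    have : (Fintype.card A : ℝ) * (6 * (#Z * n ^ 2)) = ∑ a : A, 6 * ((#Z : ℝ) * n ^ 2) := by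
      rw [Finset.sum_const, nsmul_eq_mul, Finset.card_univ]
    rw [this, ← Finset.sum_sub_distrib]
    refine Finset.sum_le_sum fun a _ => energy_vertCol_sub_le (hf0 a) (hf1 a) v lab ?_
    intro x hx y hy hxy
    exact hZ (lab x) x (hlab x hx) y (hxy ▸ hlab y hy)
  have htr : (0 : ℝ) < t := by exact_mod_cast htpos
  have hnr : (0 : ℝ) ≤ n := Nat.cast_nonneg n
  have h3 : ε * t ^ 3 * ((n : ℝ) / (2 * t)) ^ 3 ≤ ∑ k : Fin t × Fin t × Fin t with
      ∃ a, ¬ TriReg ε (f a) (V k.1) (V k.2.1) (V k.2.2),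
        (#(V k.1 ×ˢ V k.2.1 ×ˢ V k.2.2) : ℝ) := by
    refine (mul_le_mul_of_nonneg_right hbad.le (by positivity)).trans ?_
    rw [← nsmul_eq_mul]
    refine Finset.card_nsmul_le_sum _ _ _ fun k _ => ?_
    simp only [Finset.card_product]
    push_cast
    have ha := hV.half_le_card htpos hn
    have hb : (0 : ℝ) ≤ n / (2 * t) := by positivity
    calc ((n : ℝ) / (2 * t)) ^ 3 = n / (2 * t) * (n / (2 * t) * (n / (2 * t))) := by ring
      _ ≤ _ := by
        gcongr
        · exact ha k.1
        · exact ha k.2.1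
        · exact ha k.2.2
  have h4 : ε * t ^ 3 * ((n : ℝ) / (2 * t)) ^ 3 = ε * n ^ 3 / 8 := by
    field_simp
    ring
  rw [h4] at h3
  have h5 := mul_le_mul_of_nonneg_left h3 (sq_nonneg ε)
  have h6 : (Fintype.card A : ℝ) * (6 * (#Z * n ^ 2)) ≤ ε ^ 3 / 16 * n ^ 3 := by
    have e1 : (Fintype.card A : ℝ) * (6 * (#Z * n ^ 2)) * t ≤ ε ^ 3 / 16 * n ^ 3 * t := by
      calc (Fintype.card A : ℝ) * (6 * (#Z * n ^ 2)) * t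
          = Fintype.card A * 6 * (n : ℝ) ^ 2 * (#Z * t) := by ring
        _ ≤ Fintype.card A * 6 * (n : ℝ) ^ 2 * (C * n) := by gcongr
        _ = (96 * Fintype.card A * C) * ((n : ℝ) ^ 3 / 16) := by ring
        _ ≤ (ε ^ 3 * t) * (n ^ 3 / 16) := by gcongr
        _ = _ := by ring
    exact le_of_mul_le_mul_right e1 htr
  nlinarith

/-- Weak regularity for finitely many functions of three variables. -/
theorem weak_regularity {A : Type} [Fintype A] {ε : ℝ} (hε : 0 < ε) (t₀ : ℕ) :
    ∃ T n₀ : ℕ, ∀ n, n₀ ≤ n → ∀ f : A → ℕ × ℕ × ℕ → ℝ, (∀ a x, 0 ≤ f a x) →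
      (∀ a x, f a x ≤ 1) →
      ∃ t V, t₀ ≤ t ∧ t ≤ T ∧ EquiPart n t V ∧
        (#{k : Fin t × Fin t × Fin t | ∃ a, ¬ TriReg ε (f a) (V k.1) (V k.2.1) (V k.2.2)} : ℝ)
          ≤ ε * t ^ 3 := by
  obtain ⟨T, n₀, h⟩ := energy_iteration
    (O := {o : ℕ × (A → ℕ × ℕ × ℕ → ℝ) //
      0 < o.1 ∧ (∀ a x, 0 ≤ o.2 a x) ∧ ∀ a x, o.2 a x ≤ 1}) (fun o => o.1.1)
    (fun T o => ∃ t V, t₀ ≤ t ∧ t ≤ T ∧ EquiPart o.1.1 t V ∧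
        (#{k : Fin t × Fin t × Fin t |
          ∃ a, ¬ TriReg ε (o.1.2 a) (V k.1) (V k.2.1) (V k.2.2)} : ℝ) ≤ ε * t ^ 3)
    (fun T T' o hT ⟨t, V, h1, h2, h3⟩ => ⟨t, V, h1, h2.trans hT, h3⟩)
    (fun C q o => ∃ v : ℕ → Fin C,
      q * o.1.1 ^ 3 ≤ ∑ a, energy (cube o.1.1) (vertCol v) (o.1.2 a))
    (η := ε ^ 3 / 16) (M := Fintype.card A) (by positivity) 1 0 0
    (fun o _ => Or.inr ⟨fun _ => 0, by
      rw [zero_mul]; exact Finset.sum_nonneg fun a _ => energy_nonneg⟩)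
    (fun C => by
      obtain ⟨C', T, n₀, h⟩ := weak_regularity_step (A := A) hε t₀ C
      exact ⟨C', T, n₀, fun o ho q ⟨v, hv⟩ => h o.1.1 ho o.1.2 o.2.2.1 o.2.2.2 v q hv⟩)
    (fun C q o ⟨v, hv⟩ => by
      have h1 : ∑ a, energy (cube o.1.1) (vertCol v) (o.1.2 a) ≤
          ∑ a : A, (o.1.1 : ℝ) ^ 3 := Finset.sum_le_sum fun a _ => by
        rw [← card_cube]; exact energy_le_card (o.2.2.1 a) (o.2.2.2 a)
      rw [Finset.sum_const, nsmul_eq_mul, Finset.card_univ] at h1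
      have h2 : (0 : ℝ) < (o.1.1 : ℝ) ^ 3 := by
        have := o.2.1
        positivity
      exact le_of_mul_le_mul_right (hv.trans h1) h2)
  exact ⟨T, max n₀ 1, fun n hn f hf0 hf1 =>
    h ⟨(n, f), (le_max_right _ _).trans hn, hf0, hf1⟩ ((le_max_left _ _).trans hn)⟩

theorem exp_le_one_add_add_sq {x : ℝ} (hx : |x| ≤ 1) : Real.exp x ≤ 1 + x + x ^ 2 := by
  have h := Real.abs_exp_sub_one_sub_id_le hx
  linarith [le_abs_self (Real.exp x - 1 - x)]

/-- Derandomised independent labelling: labels can be chosen so that all tests with mean zero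
have small sums. -/
theorem exists_labelling {E J τ : Type*} [Fintype J] [Nonempty J] (S : Finset E)
    {π : E → J → ℝ} (hπ0 : ∀ e j, 0 ≤ π e j) (hπ1 : ∀ e ∈ S, ∑ j, π e j = 1) (𝒯 : Finset τ)
    {a : τ → E → J → ℝ} (ha : ∀ k e j, |a k e j| ≤ 1)
    (hmean : ∀ k, ∀ e ∈ S, ∑ j, π e j * a k e j = 0) {lam : ℝ} (hl0 : 0 < lam) (hl1 : lam ≤ 1) :
    ∃ ξ : E → J, (∀ e ∈ S, 0 < π e (ξ e)) ∧
      ∀ k ∈ 𝒯, ∑ e ∈ S, a k e (ξ e) ≤ Real.log #𝒯 / lam + lam * #S := by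
  classical
  have key : ∃ ξ : E → J, (∀ e ∈ S, 0 < π e (ξ e)) ∧
      ∑ k ∈ 𝒯, Real.exp (lam * ∑ e ∈ S, a k e (ξ e)) ≤ #𝒯 * Real.exp (lam ^ 2 * #S) := by
    induction S using Finset.induction_on with
    | empty => exact ⟨fun _ => Classical.arbitrary J, by simp, by simp⟩
    | insert e S he ih =>
      obtain ⟨ξ, hξ, hsum⟩ := ih (fun x hx => hπ1 x (Finset.mem_insert_of_mem hx))
        (fun k x hx => hmean k x (Finset.mem_insert_of_mem hx))
      set w : τ → ℝ := fun k => Real.exp (lam * ∑ e ∈ S, a k e (ξ e)) with hw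
      have hw0 : ∀ k, 0 ≤ w k := fun k => (Real.exp_pos _).le
      have h1 := hπ1 e (Finset.mem_insert_self e S)
      have havg : ∑ j, π e j * ∑ k ∈ 𝒯, w k * Real.exp (lam * a k e j) ≤
          (1 + lam ^ 2) * ∑ k ∈ 𝒯, w k := by
        simp only [Finset.mul_sum]
        rw [Finset.sum_comm]
        refine Finset.sum_le_sum fun k _ => ?_
        have h0 := hmean k e (Finset.mem_insert_self e S)
        calc ∑ j, π e j * (w k * Real.exp (lam * a k e j))
            ≤ ∑ j, (w k * (1 + lam ^ 2) * π e j + w k * lam * (π e j * a k e j)) := by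
              refine Finset.sum_le_sum fun j _ => ?_
              have hb : |lam * a k e j| ≤ 1 := by
                rw [abs_mul, abs_of_pos hl0]
                exact mul_le_one₀ hl1 (abs_nonneg _) (ha k e j)
              have hsq : (lam * a k e j) ^ 2 ≤ lam ^ 2 := by
                rw [mul_pow]
                exact mul_le_of_le_one_right (sq_nonneg _)
                  ((sq_le_one_iff_abs_le_one _).2 (ha k e j))
              have hexp : Real.exp (lam * a k e j) ≤ 1 + lam ^ 2 + lam * a k e j := by
                linarith [exp_le_one_add_add_sq hb]
              have := mul_le_mul_of_nonneg_left hexp (mul_nonneg (hπ0 e j) (hw0 k))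
              linarith
          _ = (1 + lam ^ 2) * w k := by
              rw [Finset.sum_add_distrib, ← Finset.mul_sum, ← Finset.mul_sum, h1, h0]
              ring
      obtain ⟨j, hj, hjle⟩ : ∃ j, 0 < π e j ∧
          ∑ k ∈ 𝒯, w k * Real.exp (lam * a k e j) ≤ (1 + lam ^ 2) * ∑ k ∈ 𝒯, w k := by
        by_contra! hcon
        obtain ⟨j₀, -, hj₀⟩ : ∃ j ∈ (Finset.univ : Finset J), 0 < π e j :=
          Finset.exists_lt_of_sum_lt (f := fun _ => (0 : ℝ)) (by simp [h1])
        refine absurd havg (not_le.2 ?_)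
        calc (1 + lam ^ 2) * ∑ k ∈ 𝒯, w k
            = ∑ j, π e j * ((1 + lam ^ 2) * ∑ k ∈ 𝒯, w k) := by
              rw [← Finset.sum_mul, h1, one_mul]
          _ < _ := by
              refine Finset.sum_lt_sum (fun j _ => ?_) ⟨j₀, Finset.mem_univ _, ?_⟩
              · rcases (hπ0 e j).eq_or_lt with h | h
                · simp [← h]
                · exact mul_le_mul_of_nonneg_left (hcon j h).le h.le
              · exact mul_lt_mul_of_pos_left (hcon j₀ hj₀) hj₀
      have hag : ∀ x ∈ S, Function.update ξ e j x = ξ x := fun x hx =>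
        Function.update_of_ne (ne_of_mem_of_not_mem hx he) _ _
      refine ⟨Function.update ξ e j, ?_, ?_⟩
      · intro x hx
        rcases Finset.mem_insert.1 hx with rfl | hx
        · simpa using hj
        · rw [hag x hx]
          exact hξ x hx
      · have hrew : ∀ k, Real.exp (lam * ∑ x ∈ insert e S, a k x (Function.update ξ e j x)) =
            w k * Real.exp (lam * a k e j) := by
          intro k
          rw [Finset.sum_insert he, Function.update_self, mul_add, Real.exp_add, mul_comm, hw,
            Finset.sum_congr rfl fun x hx => by rw [hag x hx]]
        simp only [hrew]
        have hone : 1 + lam ^ 2 ≤ Real.exp (lam ^ 2) := by linarith [Real.add_one_le_exp (lam ^ 2)]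
        rw [Finset.card_insert_of_notMem he]
        push_cast
        rw [mul_add, Real.exp_add]
        calc _ ≤ (1 + lam ^ 2) * ∑ k ∈ 𝒯, w k := hjle
          _ ≤ Real.exp (lam ^ 2) * (#𝒯 * Real.exp (lam ^ 2 * #S)) :=
              mul_le_mul hone hsum (Finset.sum_nonneg fun k _ => hw0 k) (Real.exp_pos _).le
          _ = _ := by ring_nf
  obtain ⟨ξ, hξ, hsum⟩ := key
  refine ⟨ξ, hξ, fun k hk => ?_⟩
  have h1 := (Finset.single_le_sum (f := fun k => Real.exp (lam * ∑ e ∈ S, a k e (ξ e)))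
    (fun k _ => (Real.exp_pos _).le) hk).trans hsum
  have hT : (0 : ℝ) < #𝒯 := by exact_mod_cast Finset.card_pos.2 ⟨k, hk⟩
  have h2 := Real.log_le_log (Real.exp_pos _) h1
  rw [Real.log_exp, Real.log_mul hT.ne' (Real.exp_pos _).ne', Real.log_exp] at h2
  have h3 : lam * (Real.log #𝒯 / lam + lam * #S) = Real.log #𝒯 + lam ^ 2 * #S := by
    field_simp
  exact le_of_mul_le_mul_left (h2.trans_eq h3.symm) hl0

/-- A probability vector is split into `ℓ` equal bins, with few bins of mixed content. -/
theorem exists_binning {C ℓ : ℕ} (hℓ : 0 < ℓ) {d : ℕ → ℝ} (hd0 : ∀ c, 0 ≤ d c)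
    (hd1 : ∑ c ∈ range C, d c = 1) :
    ∃ p : ℕ → ℕ → ℝ, (∀ c α, 0 ≤ p c α) ∧
      (∀ c < C, ∑ α ∈ range ℓ, p c α = d c) ∧ (∀ α < ℓ, ∑ c ∈ range C, p c α = 1 / ℓ) ∧
      ∃ I : Finset ℕ, #I ≤ C ∧ ∀ α ∉ I, ∀ c < C, ∀ c' < C, 0 < p c α → 0 < p c' α → c = c' := by
  set D : ℕ → ℝ := fun i => ∑ c ∈ range i, d c with hD
  have hDs : ∀ i, D (i + 1) = D i + d i := fun i => Finset.sum_range_succ _ _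
  have hDm : Monotone D := monotone_nat_of_le_succ fun i => by linarith [hDs i, hd0 i]
  have hD0 : ∀ i, 0 ≤ D i := fun i => Finset.sum_nonneg fun c _ => hd0 c
  have hD1 : ∀ i ≤ C, D i ≤ 1 := fun i hi => hd1 ▸ hDm hi
  have hℓr : (0 : ℝ) < ℓ := by exact_mod_cast hℓ
  set J : ℕ → ℝ := fun α => (α : ℝ) / ℓ with hJ
  have hJs : ∀ α, J (α + 1) = J α + 1 / ℓ := fun α => by simp only [hJ]; push_cast; ring
  have hJ0 : ∀ α, 0 ≤ J α := fun α => by positivity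
  have hJ1 : ∀ α ≤ ℓ, J α ≤ 1 := fun α hα => by
    rw [hJ, div_le_one hℓr]
    exact_mod_cast hα
  have hJlt : ∀ α, J α ≤ J (α + 1) := fun α => by
    rw [hJs]
    linarith [div_pos one_pos hℓr]
  refine ⟨fun c α => min (D (c + 1)) (J (α + 1)) - min (D c) (J (α + 1)) -
      (min (D (c + 1)) (J α) - min (D c) (J α)), fun c α => ?_, fun c hc => ?_, fun α hα => ?_,
      (range C).image fun c => ⌊D c * ℓ⌋₊, Finset.card_image_le.trans (card_range C).le, ?_⟩
  · have h1 := hDm (Nat.le_succ c)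
    have h2 := hJlt α
    simp only [Nat.succ_eq_add_one] at h1
    simp only [min_def]
    split_ifs <;> linarith
  · rw [Finset.sum_range_sub (fun α => min (D (c + 1)) (J α) - min (D c) (J α))]
    have e1 : J ℓ = 1 := div_self hℓr.ne'
    have e0 : J 0 = 0 := by simp [hJ]
    rw [e1, e0, min_eq_left (hD1 _ hc), min_eq_left (hD1 _ hc.le), min_eq_right (hD0 _),
      min_eq_right (hD0 _), hDs]
    ring
  · have : ∀ c, min (D (c + 1)) (J (α + 1)) - min (D c) (J (α + 1)) -
        (min (D (c + 1)) (J α) - min (D c) (J α)) =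
        (min (D (c + 1)) (J (α + 1)) - min (D (c + 1)) (J α)) -
        (min (D c) (J (α + 1)) - min (D c) (J α)) := fun c => by ring
    simp only [this]
    rw [Finset.sum_range_sub (fun c => min (D c) (J (α + 1)) - min (D c) (J α))]
    have e1 : D C = 1 := hd1
    have e0 : D 0 = 0 := by simp [hD]
    rw [e1, e0, min_eq_right (hJ1 _ hα), min_eq_right (hJ1 _ hα.le), min_eq_left (hJ0 _),
      min_eq_left (hJ0 _), hJs]
    ring
  · have hpos : ∀ c α, 0 < min (D (c + 1)) (J (α + 1)) - min (D c) (J (α + 1)) -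
        (min (D (c + 1)) (J α) - min (D c) (J α)) → D c < J (α + 1) ∧ J α < D (c + 1) := by
      intro c α h
      have h1 := hDm (Nat.le_succ c)
      have h2 := hJlt α
      simp only [Nat.succ_eq_add_one] at h1
      constructor
      · by_contra! hc
        rw [min_eq_right (hc.trans h1), min_eq_right hc, min_eq_right ((h2.trans hc).trans h1),
          min_eq_right (h2.trans hc)] at h
        linarith
      · by_contra! hc
        rw [min_eq_left (hc.trans h2), min_eq_left ((h1.trans hc).trans h2), min_eq_left hc,
          min_eq_left (h1.trans hc)] at h
        linarith
    have key : ∀ α, α ∉ (range C).image (fun c => ⌊D c * ℓ⌋₊) → ∀ c, ∀ c' < C, c < c' →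
        J α < D (c + 1) → D c' < J (α + 1) → False := by
      intro α hα c c' hc' hcc h1 h2
      refine hα (Finset.mem_image.2 ⟨c', Finset.mem_range.2 hc', ?_⟩)
      rw [Nat.floor_eq_iff (mul_nonneg (hD0 _) hℓr.le)]
      have h3 : J α < D c' := h1.trans_le (hDm hcc)
      simp only [hJ] at h2 h3
      rw [div_lt_iff₀ hℓr] at h3
      rw [lt_div_iff₀ hℓr] at h2
      push_cast at h2
      exact ⟨h3.le, h2⟩
    intro α hα c hc c' hc' h h'
    obtain ⟨h1, h2⟩ := hpos c α h
    obtain ⟨h3, h4⟩ := hpos c' α h'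
    rcases lt_trichotomy c c' with hlt | heq | hlt
    · exact (key α hα c c' hc' hlt h2 h3).elim
    · exact heq
    · exact (key α hα c' c hc hlt h4 h1).elim

/-- A coloured complete bipartite graph all of whose colour classes are regular can be split into
`ℓ` regular graphs of equal density, all but few of which are monochromatic. -/
theorem exists_regular_split {C ℓ : ℕ} (hℓ : 0 < ℓ) {δ ε : ℝ} (hδ : 0 < δ) (hδ1 : δ ≤ 1)
    (hε : C * ε ≤ δ / 2) {X Y : Finset ℕ}
    (hlarge : 16 * ((#X : ℝ) + #Y + 1 + ℓ) ≤ δ ^ 2 * (#X * #Y)) {b : ℕ × ℕ → ℕ}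
    (hb : ∀ e, b e < C)
    (hreg : ∀ c, ∀ X' ⊆ X, ∀ Y' ⊆ Y, |(#{e ∈ X' ×ˢ Y' | b e = c} : ℝ) -
      (#{e ∈ X ×ˢ Y | b e = c} : ℝ) / (#X * #Y) * (#X' * #Y')| ≤ ε * (#X * #Y)) :
    ∃ ξ : ℕ × ℕ → Fin ℓ,
      (∀ α, ∀ X' ⊆ X, ∀ Y' ⊆ Y,
        |(#{e ∈ X' ×ˢ Y' | ξ e = α} : ℝ) - 1 / ℓ * (#X' * #Y')| ≤ δ * (#X * #Y)) ∧
      ∃ I : Finset (Fin ℓ), #I ≤ C ∧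
        ∀ e ∈ X ×ˢ Y, ∀ e' ∈ X ×ˢ Y, ξ e = ξ e' → ξ e ∉ I → b e = b e' := by
  have hXY : (0 : ℝ) < #X * #Y := by
    by_contra! h
    have h0 : (0 : ℝ) < 16 * ((#X : ℝ) + #Y + 1 + ℓ) := by positivity
    nlinarith [mul_nonneg (sq_nonneg δ) (neg_nonneg.2 h)]
  have hℓr : (0 : ℝ) < ℓ := by exact_mod_cast hℓ
  have : Nonempty (Fin ℓ) := ⟨⟨0, hℓ⟩⟩
  set d : ℕ → ℝ := fun c => (#{e ∈ X ×ˢ Y | b e = c} : ℝ) / (#X * #Y) with hd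
  have hd0 : ∀ c, 0 ≤ d c := fun c => by positivity
  have hd1 : ∑ c ∈ range C, d c = 1 := by
    rw [hd, ← Finset.sum_div, div_eq_one_iff_eq hXY.ne']
    have := Finset.card_eq_sum_card_fiberwise (f := b) (s := X ×ˢ Y) (t := range C)
      fun e _ => Finset.mem_coe.2 (Finset.mem_range.2 (hb e))
    rw [Finset.card_product] at this
    exact_mod_cast this.symm
  obtain ⟨p, hp0, hpd, hpℓ, I, hIC, hI⟩ := exists_binning hℓ hd0 hd1
  have hple : ∀ c < C, ∀ α < ℓ, p c α ≤ d c := fun c hc α hα =>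
    hpd c hc ▸ Finset.single_le_sum (f := fun α => p c α) (fun α _ => hp0 c α)
      (Finset.mem_range.2 hα)
  set π : ℕ × ℕ → Fin ℓ → ℝ := fun e α => p (b e) α / d (b e) with hπ
  have hπ0 : ∀ e j, 0 ≤ π e j := fun e j => div_nonneg (hp0 _ _) (hd0 _)
  have hπle : ∀ e j, π e j ≤ 1 := fun e j =>
    div_le_one_of_le₀ (hple _ (hb e) _ j.2) (hd0 _)
  have hdpos : ∀ e ∈ X ×ˢ Y, 0 < d (b e) := by
    intro e he
    have : (0 : ℝ) < #{x ∈ X ×ˢ Y | b x = b e} := by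
      exact_mod_cast Finset.card_pos.2 ⟨e, by simpa using he⟩
    exact div_pos this hXY
  have hπ1 : ∀ e ∈ X ×ˢ Y, ∑ j, π e j = 1 := by
    intro e he
    rw [hπ, ← Finset.sum_div, Fin.sum_univ_eq_sum_range (fun α => p (b e) α), hpd _ (hb e),
      div_self (hdpos e he).ne']
  set a : (Finset ℕ × Finset ℕ × Fin ℓ × Bool) → ℕ × ℕ → Fin ℓ → ℝ := fun k e j =>
    if e ∈ k.1 ×ˢ k.2.1 then
      (if k.2.2.2 then (1 : ℝ) else -1) * ((if j = k.2.2.1 then 1 else 0) - π e k.2.2.1)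
    else 0 with ha
  have ha1 : ∀ k e j, |a k e j| ≤ 1 := by
    intro k e j
    have h0 := hπ0 e k.2.2.1
    have h1 := hπle e k.2.2.1
    simp only [ha]
    rw [abs_le]
    split_ifs <;> constructor <;> linarith
  have hmean : ∀ k, ∀ e ∈ X ×ˢ Y, ∑ j, π e j * a k e j = 0 := by
    intro k e he
    simp only [ha]
    by_cases hk : e ∈ k.1 ×ˢ k.2.1
    · simp only [if_pos hk]
      have : ∀ j, π e j * ((if k.2.2.2 then (1 : ℝ) else -1) *
          ((if j = k.2.2.1 then 1 else 0) - π e k.2.2.1)) =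
          (if k.2.2.2 then (1 : ℝ) else -1) *
          ((if j = k.2.2.1 then π e j else 0) - π e j * π e k.2.2.1) := by
        intro j
        split_ifs <;> ring
      simp only [this]
      rw [← Finset.mul_sum, Finset.sum_sub_distrib, ← Finset.sum_mul, hπ1 e he]
      simp
    · simp only [if_neg hk, mul_zero, Finset.sum_const_zero]
  set 𝒯 : Finset (Finset ℕ × Finset ℕ × Fin ℓ × Bool) :=
    X.powerset ×ˢ Y.powerset ×ˢ Finset.univ with h𝒯
  have hcard : Real.log #𝒯 ≤ #X + #Y + 1 + ℓ := by
    have h1 : (#𝒯 : ℝ) = 2 ^ #X * (2 ^ #Y * (ℓ * 2)) := by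
      simp only [h𝒯, Finset.card_product, Finset.card_powerset, Finset.card_univ, Fintype.card_prod,
        Fintype.card_fin, Fintype.card_bool]
      push_cast
      ring
    rw [h1, Real.log_mul (by positivity) (by positivity),
      Real.log_mul (by positivity) (by positivity), Real.log_mul (by positivity) (by positivity),
      Real.log_pow, Real.log_pow]
    have h2 : Real.log 2 ≤ 1 := by linarith [Real.log_two_lt_d9]
    have h3 : Real.log ℓ ≤ ℓ := by linarith [Real.log_le_sub_one_of_pos hℓr]
    have h4 : (#X : ℝ) * Real.log 2 ≤ #X := mul_le_of_le_one_right (Nat.cast_nonneg _) h2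
    have h5 : (#Y : ℝ) * Real.log 2 ≤ #Y := mul_le_of_le_one_right (Nat.cast_nonneg _) h2
    linarith
  obtain ⟨ξ, hξpos, hξ⟩ := exists_labelling (X ×ˢ Y) hπ0 hπ1 𝒯 ha1 hmean
    (lam := δ / 4) (by linarith) (by linarith)
  have hbound : Real.log #𝒯 / (δ / 4) + δ / 4 * #(X ×ˢ Y) ≤ δ / 2 * (#X * #Y) := by
    have h1 : Real.log #𝒯 / (δ / 4) ≤ δ / 4 * (#X * #Y) := by
      rw [div_le_iff₀ (by linarith)]
      nlinarith
    have h2 : (#(X ×ˢ Y) : ℝ) = #X * #Y := by rw [Finset.card_product, Nat.cast_mul]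
    rw [h2]
    linarith
  refine ⟨ξ, fun α X' hX' Y' hY' => ?_, Finset.univ.filter fun α => (α : ℕ) ∈ I, ?_, ?_⟩
  · have hsub : X' ×ˢ Y' ⊆ X ×ˢ Y := Finset.product_subset_product hX' hY'
    have hdev : |∑ e ∈ X' ×ˢ Y', ((if ξ e = α then (1 : ℝ) else 0) - π e α)| ≤
        δ / 2 * (#X * #Y) := by
      have hk : ∀ σ : Bool, (if σ then (1 : ℝ) else -1) *
          ∑ e ∈ X' ×ˢ Y', ((if ξ e = α then (1 : ℝ) else 0) - π e α) ≤ δ / 2 * (#X * #Y) := by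
        intro σ
        refine le_trans (le_of_eq ?_) ((hξ (X', Y', α, σ) ?_).trans hbound)
        · rw [Finset.mul_sum]
          simp only [ha]
          rw [Finset.sum_ite_mem, Finset.inter_eq_right.2 hsub]
        · simp only [h𝒯, Finset.mem_product, Finset.mem_powerset, Finset.mem_univ, and_true]
          exact ⟨hX', hY'⟩
      have h1 := hk true
      have h2 := hk false
      simp only [if_true, one_mul, Bool.false_eq_true, if_false, neg_one_mul] at h1 h2
      exact abs_le.2 ⟨by linarith, h1⟩
    have hmain : |∑ e ∈ X' ×ˢ Y', π e α - 1 / ℓ * (#X' * #Y')| ≤ δ / 2 * (#X * #Y) := by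
      have h1 : ∑ e ∈ X' ×ˢ Y', π e α =
          ∑ c ∈ range C, (#{e ∈ X' ×ˢ Y' | b e = c} : ℝ) * (p c α / d c) := by
        rw [← Finset.sum_fiberwise_of_maps_to (g := b) (t := range C)
          (fun e _ => Finset.mem_range.2 (hb e))]
        refine Finset.sum_congr rfl fun c _ => ?_
        rw [← nsmul_eq_mul, ← Finset.sum_const]
        refine Finset.sum_congr rfl fun e he => ?_
        simp only [hπ, (Finset.mem_filter.1 he).2]
      rw [h1, ← hpℓ α α.2, Finset.sum_mul, ← Finset.sum_sub_distrib]
      refine (Finset.abs_sum_le_sum_abs _ _).trans ?_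
      have h2 : ∀ c ∈ range C, |(#{e ∈ X' ×ˢ Y' | b e = c} : ℝ) * (p c α / d c) -
          p c α * (#X' * #Y')| ≤ ε * (#X * #Y) := by
        intro c hc
        have hc' := Finset.mem_range.1 hc
        have hr := hreg c X' hX' Y' hY'
        have hle : p c α / d c ≤ 1 := div_le_one_of_le₀ (hple c hc' α α.2) (hd0 c)
        have h0 : 0 ≤ p c α / d c := div_nonneg (hp0 _ _) (hd0 _)
        have heq : p c α = p c α / d c * d c := by
          rcases eq_or_ne (d c) 0 with h | h
          · have := hple c hc' α α.2
            rw [h] at this ⊢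
            rw [mul_zero]
            exact le_antisymm this (hp0 c α)
          · rw [div_mul_cancel₀ _ h]
        have : (#{e ∈ X' ×ˢ Y' | b e = c} : ℝ) * (p c α / d c) - p c α * (#X' * #Y') =
            p c α / d c * ((#{e ∈ X' ×ˢ Y' | b e = c} : ℝ) - d c * (#X' * #Y')) := by
          conv_lhs => rw [show p c α * ((#X' : ℝ) * #Y') = p c α / d c * d c * (#X' * #Y') by
            rw [← heq]]
          ring
        rw [this, abs_mul, abs_of_nonneg h0]
        exact (mul_le_of_le_one_left (abs_nonneg _) hle).trans hr
      refine (Finset.sum_le_sum h2).trans ?_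
      rw [Finset.sum_const, card_range, nsmul_eq_mul, ← mul_assoc]
      exact mul_le_mul_of_nonneg_right hε hXY.le
    have hcount : (#{e ∈ X' ×ˢ Y' | ξ e = α} : ℝ) - 1 / ℓ * (#X' * #Y') =
        ∑ e ∈ X' ×ˢ Y', ((if ξ e = α then (1 : ℝ) else 0) - π e α) +
        (∑ e ∈ X' ×ˢ Y', π e α - 1 / ℓ * (#X' * #Y')) := by
      rw [Finset.sum_sub_distrib, Finset.sum_boole]
      ring
    rw [hcount]
    refine (abs_add_le _ _).trans ?_
    linarith
  · refine le_trans ?_ hIC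
    exact Finset.card_le_card_of_injOn (fun α : Fin ℓ => (α : ℕ))
      (fun α hα => (Finset.mem_filter.1 hα).2) fun x _ y _ h => Fin.ext h
  · intro e he e' he' heq hn
    have hn' : ((ξ e : Fin ℓ) : ℕ) ∉ I := by simpa using hn
    have hpos : ∀ e ∈ X ×ˢ Y, 0 < p (b e) (ξ e) := by
      intro e he
      have := hξpos e he
      simp only [hπ] at this
      exact (div_pos_iff_of_pos_right (hdpos e he)).1 this
    have h1 := hpos e he
    have h2 := hpos e' he'
    rw [← heq] at h2
    exact hI _ hn' _ (hb e) _ (hb e') h1 h2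

theorem pair_inj {X Y : Finset ℕ} (h : Disjoint X Y) {x x' y y' : ℕ} (hx : x ∈ X) (hx' : x' ∈ X)
    (hy : y ∈ Y) (hy' : y' ∈ Y) (he : ({x, y} : Finset ℕ) = {x', y'}) : x = x' ∧ y = y' := by
  have h1 : x ∈ ({x', y'} : Finset ℕ) := he ▸ by simp
  have h2 : y ∈ ({x', y'} : Finset ℕ) := he ▸ by simp
  have h3 := Finset.disjoint_left.1 h
  simp only [Finset.mem_insert, Finset.mem_singleton] at h1 h2
  constructor
  · rcases h1 with rfl | rfl
    · rfl
    · exact absurd hy' (h3 hx)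
  · rcases h2 with rfl | rfl
    · exact absurd hy (h3 hx')
    · rfl

theorem triple_inj {X Y Z : Finset ℕ} (hXY : Disjoint X Y) (hXZ : Disjoint X Z)
    (hYZ : Disjoint Y Z) :
    Set.InjOn (fun p : ℕ × ℕ × ℕ => ({p.1, p.2.1, p.2.2} : Finset ℕ)) ↑(X ×ˢ Y ×ˢ Z) := by
  rintro ⟨x, y, z⟩ hp ⟨x', y', z'⟩ hp' he
  simp only [Finset.coe_product, Set.mem_prod, Finset.mem_coe] at hp hp' he
  obtain ⟨hx, hy, hz⟩ := hp
  obtain ⟨hx', hy', hz'⟩ := hp'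
  have h1 : x ∈ ({x', y', z'} : Finset ℕ) := he ▸ by simp
  have h2 : y ∈ ({x', y', z'} : Finset ℕ) := he ▸ by simp
  have h3 : z ∈ ({x', y', z'} : Finset ℕ) := he ▸ by simp
  simp only [Finset.mem_insert, Finset.mem_singleton] at h1 h2 h3
  have d1 : ∀ a ∈ X, a ∉ Y := fun _ h => Finset.disjoint_left.1 hXY h
  have d2 : ∀ a ∈ X, a ∉ Z := fun _ h => Finset.disjoint_left.1 hXZ h
  have d3 : ∀ a ∈ Y, a ∉ Z := fun _ h => Finset.disjoint_left.1 hYZ h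
  have e1 : x = x' := by
    rcases h1 with h | h | h
    · exact h
    · exact absurd (h ▸ hy') (d1 x hx)
    · exact absurd (h ▸ hz') (d2 x hx)
  have e2 : y = y' := by
    rcases h2 with h | h | h
    · exact absurd hy (h ▸ d1 x' hx')
    · exact h
    · exact absurd (h ▸ hz') (d3 y hy)
  have e3 : z = z' := by
    rcases h3 with h | h | h
    · exact absurd hz (h ▸ d2 x' hx')
    · exact absurd hz (h ▸ d3 y' hy')
    · exact h
  rw [e1, e2, e3]

theorem e3_eq {X Y Z : Finset ℕ} (hXY : Disjoint X Y) (hXZ : Disjoint X Z) (hYZ : Disjoint Y Z)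
    (E : Finset (Finset ℕ)) :
    e3 E X Y Z = #{p ∈ X ×ˢ Y ×ˢ Z | ({p.1, p.2.1, p.2.2} : Finset ℕ) ∈ E} := by
  rw [e3, ← Finset.card_image_of_injOn ((triple_inj hXY hXZ hYZ).mono
    (Finset.coe_subset.2 (Finset.filter_subset
      (fun p : ℕ × ℕ × ℕ => ({p.1, p.2.1, p.2.2} : Finset ℕ) ∈ E) _)))]
  congr 1
  ext e
  simp only [Finset.mem_filter, Finset.mem_image, Finset.mem_product, Prod.exists]
  constructor
  · rintro ⟨he, x, hx, y, hy, z, hz, rfl⟩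
    exact ⟨x, y, z, ⟨⟨hx, hy, hz⟩, he⟩, rfl⟩
  · rintro ⟨x, y, z, ⟨⟨hx, hy, hz⟩, he⟩, rfl⟩
    exact ⟨he, x, hx, y, hy, z, hz, rfl⟩

/-- The indicator function of a 3-graph on ordered triples. -/
noncomputable def edgeInd (E : Finset (Finset ℕ)) (p : ℕ × ℕ × ℕ) : ℝ :=
  if ({p.1, p.2.1, p.2.2} : Finset ℕ) ∈ E then 1 else 0

theorem edgeInd_nonneg (E : Finset (Finset ℕ)) (p : ℕ × ℕ × ℕ) : 0 ≤ edgeInd E p := by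
  unfold edgeInd
  split_ifs <;> norm_num

theorem edgeInd_le_one (E : Finset (Finset ℕ)) (p : ℕ × ℕ × ℕ) : edgeInd E p ≤ 1 := by
  unfold edgeInd
  split_ifs <;> norm_num

theorem TriReg.weakRegular {ε δ : ℝ} (hεδ : ε ≤ δ) {E : Finset (Finset ℕ)} {X Y Z : Finset ℕ}
    (hXY : Disjoint X Y) (hXZ : Disjoint X Z) (hYZ : Disjoint Y Z)
    (h : TriReg ε (edgeInd E) X Y Z) : WeakRegular δ E X Y Z := by
  intro X' hX' Y' hY' Z' hZ'
  have h1 := h X' hX' Y' hY' Z' hZ'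
  have hs : ∀ X' ⊆ X, ∀ Y' ⊆ Y, ∀ Z' ⊆ Z,
      ∑ p ∈ X' ×ˢ Y' ×ˢ Z', edgeInd E p = e3 E X' Y' Z' := by
    intro X' hX' Y' hY' Z' hZ'
    rw [e3_eq (hXY.mono hX' hY') (hXZ.mono hX' hZ') (hYZ.mono hY' hZ')]
    simp only [edgeInd, Finset.sum_boole]
  rw [hs X' hX' Y' hY' Z' hZ', hs X subset_rfl Y subset_rfl Z subset_rfl] at h1
  simp only [Finset.card_product, Nat.cast_mul, ← mul_assoc] at h1
  refine h1.trans ?_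
  gcongr

/-- The edges between `X` and `Y` with label `α`. -/
def labGraph {ℓ : ℕ} (ξ : ℕ × ℕ → Fin ℓ) (X Y : Finset ℕ) (α : Fin ℓ) : Finset (Finset ℕ) :=
  {p ∈ X ×ˢ Y | ξ p = α}.image fun p => ({p.1, p.2} : Finset ℕ)

section LabGraph

variable {ℓ : ℕ} {ξ : ℕ × ℕ → Fin ℓ} {X Y : Finset ℕ} {α β : Fin ℓ}

theorem pair_mem_labGraph (h : Disjoint X Y) {x y : ℕ} (hx : x ∈ X) (hy : y ∈ Y) :
    ({x, y} : Finset ℕ) ∈ labGraph ξ X Y α ↔ ξ (x, y) = α := by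
  simp only [labGraph, Finset.mem_image, Finset.mem_filter, Finset.mem_product, Prod.exists]
  constructor
  · rintro ⟨x', y', ⟨⟨hx', hy'⟩, hα⟩, he⟩
    obtain ⟨rfl, rfl⟩ := pair_inj h hx' hx hy' hy he
    exact hα
  · exact fun hα => ⟨x, y, ⟨⟨hx, hy⟩, hα⟩, rfl⟩

theorem exists_of_mem_labGraph {e : Finset ℕ} (he : e ∈ labGraph ξ X Y α) :
    ∃ x ∈ X, ∃ y ∈ Y, ξ (x, y) = α ∧ e = {x, y} := by
  simp only [labGraph, Finset.mem_image, Finset.mem_filter, Finset.mem_product, Prod.exists] at he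
  obtain ⟨x, y, ⟨⟨hx, hy⟩, hα⟩, rfl⟩ := he
  exact ⟨x, hx, y, hy, hα, rfl⟩

theorem disjoint_labGraph (h : Disjoint X Y) (hαβ : α ≠ β) :
    Disjoint (labGraph ξ X Y α) (labGraph ξ X Y β) := by
  rw [Finset.disjoint_left]
  intro e he he'
  obtain ⟨x, hx, y, hy, hα, rfl⟩ := exists_of_mem_labGraph he
  exact hαβ (hα.symm.trans ((pair_mem_labGraph h hx hy).1 he'))

theorem biUnion_labGraph : Finset.univ.biUnion (labGraph ξ X Y) = K2 X Y := by
  ext e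
  simp [labGraph, K2]

theorem e2_labGraph (h : Disjoint X Y) {X' Y' : Finset ℕ} (hX' : X' ⊆ X) (hY' : Y' ⊆ Y) :
    e2 (labGraph ξ X Y α) X' Y' = #{p ∈ X' ×ˢ Y' | ξ p = α} := by
  have hinj : Set.InjOn (fun p : ℕ × ℕ => ({p.1, p.2} : Finset ℕ))
      ↑({p ∈ X' ×ˢ Y' | ξ p = α} : Finset (ℕ × ℕ)) := by
    rintro ⟨x, y⟩ hp ⟨x', y'⟩ hp' he
    simp only [Finset.coe_filter, Finset.mem_product, Set.mem_ofPred_eq] at hp hp'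
    obtain ⟨h1, h2⟩ := pair_inj (h.mono hX' hY') hp.1.1 hp'.1.1 hp.1.2 hp'.1.2 he
    rw [h1, h2]
  rw [e2, ← Finset.card_image_of_injOn hinj]
  congr 1
  ext e
  simp only [Finset.mem_filter, Finset.mem_image, Finset.mem_product, Prod.exists]
  constructor
  · rintro ⟨he, x, hx, y, hy, rfl⟩
    exact ⟨x, y, ⟨⟨hx, hy⟩, (pair_mem_labGraph h (hX' hx) (hY' hy)).1 he⟩, rfl⟩
  · rintro ⟨x, y, ⟨⟨hx, hy⟩, he⟩, rfl⟩
    exact ⟨(pair_mem_labGraph h (hX' hx) (hY' hy)).2 he, x, hx, y, hy, rfl⟩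

end LabGraph

theorem triple_mem_triSets {X Y Z : Finset ℕ} (hXY : Disjoint X Y) (hXZ : Disjoint X Z)
    (hYZ : Disjoint Y Z) {G : Finset (Finset ℕ)} {p : ℕ × ℕ × ℕ} (hp : p ∈ X ×ˢ Y ×ˢ Z) :
    ({p.1, p.2.1, p.2.2} : Finset ℕ) ∈ triSets G X Y Z ↔
      ({p.1, p.2.1} : Finset ℕ) ∈ G ∧ ({p.1, p.2.2} : Finset ℕ) ∈ G ∧
        ({p.2.1, p.2.2} : Finset ℕ) ∈ G := by
  rw [triSets, Finset.mem_image]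
  constructor
  · rintro ⟨q, hq, he⟩
    obtain ⟨hq, hG⟩ := Finset.mem_filter.1 hq
    have : q = p := triple_inj hXY hXZ hYZ (Finset.mem_coe.2 hq) (Finset.mem_coe.2 hp) he
    exact this ▸ hG
  · exact fun hG => ⟨p, Finset.mem_filter.2 ⟨hp, hG⟩, rfl⟩

/-- The colouring of triples induced by a colouring of pairs. -/
def tripCol {κ : Type*} (β : ℕ × ℕ → κ) (x : ℕ × ℕ × ℕ) : κ × κ × κ :=
  (β (x.1, x.2.1), β (x.1, x.2.2), β (x.2.1, x.2.2))

theorem card_cube_filter_pair_mem_le (n : ℕ) (Z : Finset (ℕ × ℕ)) :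
    #{x ∈ cube n | (x.1, x.2.1) ∈ Z ∨ (x.1, x.2.2) ∈ Z ∨ (x.2.1, x.2.2) ∈ Z} ≤ 3 * (#Z * n) := by
  have : {x ∈ cube n | (x.1, x.2.1) ∈ Z ∨ (x.1, x.2.2) ∈ Z ∨ (x.2.1, x.2.2) ∈ Z} ⊆
      (Z ×ˢ range n).image (fun q => (q.1.1, q.1.2, q.2)) ∪
      (Z ×ˢ range n).image (fun q => (q.1.1, q.2, q.1.2)) ∪
      (Z ×ˢ range n).image (fun q => (q.2, q.1.1, q.1.2)) := by
    rintro ⟨x, y, z⟩ hx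
    obtain ⟨hx, h⟩ := Finset.mem_filter.1 hx
    obtain ⟨h1, h2, h3⟩ := mem_cube.1 hx
    simp only [Finset.mem_union, Finset.mem_image, Finset.mem_product]
    rcases h with h | h | h
    · exact Or.inl (Or.inl ⟨((x, y), z), ⟨h, h3⟩, rfl⟩)
    · exact Or.inl (Or.inr ⟨((x, z), y), ⟨h, h2⟩, rfl⟩)
    · exact Or.inr ⟨((y, z), x), ⟨h, h1⟩, rfl⟩
  have hle : ∀ g : (ℕ × ℕ) × ℕ → ℕ × ℕ × ℕ, #((Z ×ˢ range n).image g) ≤ #Z * n := fun g =>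
    Finset.card_image_le.trans_eq (by rw [Finset.card_product, Finset.card_range])
  refine (Finset.card_le_card this).trans ?_
  refine (Finset.card_union_le _ _).trans ?_
  refine (Nat.add_le_add (Finset.card_union_le _ _) le_rfl).trans ?_
  refine (Nat.add_le_add (Nat.add_le_add (hle _) (hle _)) (hle _)).trans ?_
  apply le_of_eq
  ring

theorem energy_tripCol_sub_le {κ κ' : Type*} {n : ℕ} {f : ℕ × ℕ × ℕ → ℝ} (hf0 : ∀ x, 0 ≤ f x)
    (hf1 : ∀ x, f x ≤ 1) (β : ℕ × ℕ → κ) (β' : ℕ × ℕ → κ') {Z : Finset (ℕ × ℕ)}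
    (h : ∀ p ∈ range n ×ˢ range n, ∀ q ∈ range n ×ˢ range n, β' p = β' q →
      (p ∈ Z ↔ q ∈ Z) ∧ (p ∉ Z → β p = β q)) :
    energy (cube n) (tripCol β) f - 6 * (#Z * n) ≤ energy (cube n) (tripCol β') f := by
  refine le_trans ?_ (energy_sub_le_of_refines (c := tripCol β) hf0 hf1
    {x ∈ cube n | (x.1, x.2.1) ∈ Z ∨ (x.1, x.2.2) ∈ Z ∨ (x.2.1, x.2.2) ∈ Z}
    (Finset.filter_subset _ _) ?_)
  · have h1 : (#{x ∈ cube n | (x.1, x.2.1) ∈ Z ∨ (x.1, x.2.2) ∈ Z ∨ (x.2.1, x.2.2) ∈ Z} : ℝ) ≤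
        3 * (#Z * n) := by
      exact_mod_cast card_cube_filter_pair_mem_le n Z
    linarith
  · intro x hx y hy hxy
    simp only [tripCol, Prod.mk.injEq] at hxy
    obtain ⟨hx1, hx2, hx3⟩ := mem_cube.1 hx
    obtain ⟨hy1, hy2, hy3⟩ := mem_cube.1 hy
    obtain ⟨a1, a2⟩ := h _ (Finset.mk_mem_product hx1 hx2) _ (Finset.mk_mem_product hy1 hy2) hxy.1
    obtain ⟨b1, b2⟩ := h _ (Finset.mk_mem_product hx1 hx3) _ (Finset.mk_mem_product hy1 hy3) hxy.2.1
    obtain ⟨c1, c2⟩ := h _ (Finset.mk_mem_product hx2 hx3) _ (Finset.mk_mem_product hy2 hy3) hxy.2.2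
    refine ⟨by simp only [Finset.mem_filter, hx, hy, a1, b1, c1], fun hn => ?_⟩
    simp only [Finset.mem_filter, hx, true_and, not_or] at hn
    simp only [tripCol, a2 hn.1, b2 hn.2.1, c2 hn.2.2]

/-- All colour classes of `b` are regular on the pair `(X,Y)`. -/
def PairReg (ε : ℝ) (b : ℕ × ℕ → ℕ) (X Y : Finset ℕ) : Prop :=
  ∀ c, ∀ X' ⊆ X, ∀ Y' ⊆ Y, |(#{e ∈ X' ×ˢ Y' | b e = c} : ℝ) -
    (#{e ∈ X ×ˢ Y | b e = c} : ℝ) / (#X * #Y) * (#X' * #Y')| ≤ ε * (#X * #Y)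

theorem pairReg_zero (X Y : Finset ℕ) : PairReg 0 (fun _ => 0) X Y := by
  intro c X' hX' Y' hY'
  rcases eq_or_ne 0 c with h | h
  · simp only [h, Finset.filter_true, Finset.card_product, Nat.cast_mul]
    rcases eq_or_ne ((#X : ℝ) * #Y) 0 with h0 | h0
    · have h1 : (#X' : ℝ) * #Y' ≤ #X * #Y := by
        exact_mod_cast Nat.mul_le_mul (Finset.card_le_card hX') (Finset.card_le_card hY')
      have h2 : (#X' : ℝ) * #Y' = 0 := le_antisymm (h0 ▸ h1) (by positivity)
      simp [h2]
    · rw [div_self h0]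
      simp
  · simp [h]

theorem PairReg.of_triReg {ε : ℝ} {b : ℕ × ℕ → ℕ} {X Y Z : Finset ℕ} (hZ : Z.Nonempty)
    (h : ∀ c, TriReg ε (fun p => if b (p.1, p.2.1) = c then 1 else 0) X Y Z) :
    PairReg ε b X Y := by
  intro c X' hX' Y' hY'
  have hs : ∀ X' Y' : Finset ℕ, ∑ p ∈ X' ×ˢ Y' ×ˢ Z, (if b (p.1, p.2.1) = c then (1 : ℝ) else 0) =
      (#{e ∈ X' ×ˢ Y' | b e = c} : ℝ) * #Z := by
    intro X' Y'
    rw [Finset.sum_product, ← Finset.sum_boole, Finset.sum_product, Finset.sum_mul]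
    refine Finset.sum_congr rfl fun x _ => ?_
    rw [Finset.sum_product, Finset.sum_mul]
    refine Finset.sum_congr rfl fun y _ => ?_
    by_cases hc : b (x, y) = c <;> simp [hc]
  have h1 := h c X' hX' Y' hY' Z subset_rfl
  rw [hs, hs] at h1
  simp only [Finset.card_product, Nat.cast_mul] at h1
  have hz : (0 : ℝ) < #Z := by exact_mod_cast hZ.card_pos
  have e1 : (#{e ∈ X ×ˢ Y | b e = c} : ℝ) * #Z / (#X * (#Y * #Z)) * (#X' * (#Y' * #Z)) =
      (#{e ∈ X ×ˢ Y | b e = c} : ℝ) / (#X * #Y) * (#X' * #Y') * #Z := by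
    rw [← mul_assoc (#X : ℝ), mul_div_mul_right _ _ hz.ne']
    ring
  rw [e1, ← sub_mul, abs_mul, abs_of_pos hz] at h1
  refine le_of_mul_le_mul_right (h1.trans_eq ?_) hz
  ring

/-- The labelling of pairs determined by vertex labels and labels of crossing pairs. -/
noncomputable def pairLab {t ℓ : ℕ} (lab : ℕ → Fin t) (ξ : Fin t → Fin t → ℕ × ℕ → Fin ℓ)
    (p : ℕ × ℕ) : Option (Fin t × Fin t × Fin ℓ) :=
  if lab p.1 < lab p.2 then some (lab p.1, lab p.2, ξ (lab p.1) (lab p.2) p)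
  else if lab p.2 < lab p.1 then some (lab p.2, lab p.1, ξ (lab p.2) (lab p.1) p.swap)
  else none

section PairLab

variable {t ℓ : ℕ} {lab : ℕ → Fin t} {ξ : Fin t → Fin t → ℕ × ℕ → Fin ℓ}

theorem pairLab_swap (p : ℕ × ℕ) : pairLab lab ξ p.swap = pairLab lab ξ p := by
  simp only [pairLab, Prod.fst_swap, Prod.snd_swap, Prod.swap_swap]
  split_ifs with h1 h2 h3
  · exact absurd h1 h2.asymm
  · rfl
  · rfl
  · rfl

theorem pairLab_of_lt {p : ℕ × ℕ} (h : lab p.1 < lab p.2) :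
    pairLab lab ξ p = some (lab p.1, lab p.2, ξ (lab p.1) (lab p.2) p) := if_pos h

theorem exists_of_pairLab_eq_some {p : ℕ × ℕ} {k : Fin t × Fin t × Fin ℓ}
    (h : pairLab lab ξ p = some k) : ∃ q, (q = p ∨ q = p.swap) ∧ lab q.1 < lab q.2 ∧
      k = (lab q.1, lab q.2, ξ (lab q.1) (lab q.2) q) := by
  unfold pairLab at h
  split_ifs at h with h1 h2
  · exact ⟨p, Or.inl rfl, h1, (Option.some.inj h).symm⟩
  · exact ⟨p.swap, Or.inr rfl, h2, (Option.some.inj h).symm⟩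

theorem pairLab_eq_none_iff {p : ℕ × ℕ} : pairLab lab ξ p = none ↔ lab p.1 = lab p.2 := by
  unfold pairLab
  split_ifs with h1 h2
  · simp [h1.ne]
  · simp [h2.ne']
  · simpa using le_antisymm (not_lt.1 h2) (not_lt.1 h1)

/-- The energy lost when passing from a symmetric colouring of pairs to a labelling of
the pairs crossing an equitable partition that refines it outside of an exceptional set. -/
theorem energy_pairLab_sub_le {n C : ℕ} {V : Fin t → Finset ℕ} (hV : EquiPart n t V) (ht : 0 < t)
    (htn : t ≤ n) (hlab : ∀ x ∈ range n, x ∈ V (lab x)) {b : ℕ × ℕ → ℕ}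
    (hsymm : ∀ p : ℕ × ℕ, b p.swap = b p) (bad : Finset (Fin t × Fin t)) {ε : ℝ}
    (hbad : (#bad : ℝ) ≤ ε * t ^ 2) (I : Fin t → Fin t → Finset (Fin ℓ))
    (hI : ∀ i j, i < j → (i, j) ∉ bad → #(I i j) ≤ C)
    (hreg : ∀ i j, i < j → ∀ α,
      (#{e ∈ V i ×ˢ V j | ξ i j e = α} : ℝ) ≤ 2 / ℓ * (#(V i) * #(V j)))
    (hpure : ∀ i j, i < j → (i, j) ∉ bad → ∀ e ∈ V i ×ˢ V j, ∀ e' ∈ V i ×ˢ V j,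
      ξ i j e = ξ i j e' → ξ i j e ∉ I i j → b e = b e')
    {f : ℕ × ℕ × ℕ → ℝ} (hf0 : ∀ x, 0 ≤ f x) (hf1 : ∀ x, f x ≤ 1) :
    energy (cube n) (tripCol b) f - (12 / t + 48 * ε + 24 * C / ℓ) * n ^ 3 ≤
      energy (cube n) (tripCol (pairLab lab ξ)) f := by
  have htr : (0 : ℝ) < t := by exact_mod_cast ht
  have hVle : ∀ i, (#(V i) : ℝ) ≤ 2 * n / t := by
    intro i
    rw [le_div_iff₀ htr]
    have := hV.card_le i
    have : (t : ℝ) ≤ n := by exact_mod_cast htn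
    linarith
  set P : Option (Fin t × Fin t × Fin ℓ) → Prop := fun k => k = none ∨
    ∃ i j α, k = some (i, j, α) ∧ ((i, j) ∈ bad ∨ α ∈ I i j) with hP
  set Z : Finset (ℕ × ℕ) := {p ∈ range n ×ˢ range n | P (pairLab lab ξ p)} with hZ
  set Z₀ : Finset (ℕ × ℕ) := Finset.univ.biUnion fun i => V i ×ˢ V i with hZ₀
  set Z₁ : Finset (ℕ × ℕ) := (bad.biUnion fun k => V k.1 ×ˢ V k.2) ∪
    (({k : Fin t × Fin t | k.1 < k.2 ∧ k ∉ bad} : Finset (Fin t × Fin t)).biUnion fun k =>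
      (I k.1 k.2).biUnion fun α => {e ∈ V k.1 ×ˢ V k.2 | ξ k.1 k.2 e = α}) with hZ₁
  have hZsub : Z ⊆ Z₀ ∪ (Z₁ ∪ Z₁.image Prod.swap) := by
    intro p hp
    obtain ⟨hpn, hp⟩ := Finset.mem_filter.1 hp
    obtain ⟨hp1, hp2⟩ := Finset.mem_product.1 hpn
    rcases hp with hp | ⟨i, j, α, hk, hor⟩
    · have hl := pairLab_eq_none_iff.1 hp
      refine Finset.mem_union_left _ (Finset.mem_biUnion.2 ⟨lab p.1, Finset.mem_univ _, ?_⟩)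
      exact Finset.mem_product.2 ⟨hlab _ hp1, hl ▸ hlab _ hp2⟩
    · obtain ⟨q, hqp, hlt, hq⟩ := exists_of_pairLab_eq_some hk
      have hqn : q.1 ∈ range n ∧ q.2 ∈ range n := by
        rcases hqp with rfl | rfl
        · exact ⟨hp1, hp2⟩
        · exact ⟨hp2, hp1⟩
      have hqV : q ∈ V (lab q.1) ×ˢ V (lab q.2) :=
        Finset.mem_product.2 ⟨hlab _ hqn.1, hlab _ hqn.2⟩
      simp only [Prod.mk.injEq] at hq
      obtain ⟨rfl, rfl, rfl⟩ := hq
      have hqZ : q ∈ Z₁ := by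
        by_cases hb : (lab q.1, lab q.2) ∈ bad
        · exact Finset.mem_union_left _ (Finset.mem_biUnion.2 ⟨_, hb, hqV⟩)
        · refine Finset.mem_union_right _ (Finset.mem_biUnion.2 ⟨(lab q.1, lab q.2), ?_, ?_⟩)
          · simpa using ⟨hlt, hb⟩
          · exact Finset.mem_biUnion.2 ⟨_, hor.resolve_left hb, Finset.mem_filter.2 ⟨hqV, rfl⟩⟩
      refine Finset.mem_union_right _ ?_
      rcases hqp with rfl | rfl
      · exact Finset.mem_union_left _ hqZ
      · exact Finset.mem_union_right _ (Finset.mem_image.2 ⟨_, hqZ, Prod.swap_swap p⟩)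
  have hnr : (0 : ℝ) ≤ n := Nat.cast_nonneg n
  have hsum : ∑ i, (#(V i) : ℝ) = n := by exact_mod_cast hV.sum_card
  have hZ₀c : (#Z₀ : ℝ) ≤ 2 / t * n ^ 2 := by
    calc (#Z₀ : ℝ) ≤ ∑ i, (#(V i) : ℝ) * #(V i) := by
          have : #Z₀ ≤ ∑ i, #(V i) * #(V i) :=
            Finset.card_biUnion_le.trans_eq (Finset.sum_congr rfl fun i _ =>
              Finset.card_product _ _)
          exact_mod_cast this
      _ ≤ ∑ i, 2 * n / t * (#(V i) : ℝ) := Finset.sum_le_sum fun i _ =>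
          mul_le_mul_of_nonneg_right (hVle i) (Nat.cast_nonneg _)
      _ = 2 / t * n ^ 2 := by
          rw [← Finset.mul_sum, hsum]
          ring
  have hZ₁c : (#Z₁ : ℝ) ≤ 4 * ε * n ^ 2 + 2 * C / ℓ * n ^ 2 := by
    refine (Nat.cast_le.2 (Finset.card_union_le _ _)).trans ?_
    rw [Nat.cast_add]
    refine add_le_add ?_ ?_
    · refine (Nat.cast_le.2 Finset.card_biUnion_le).trans ?_
      rw [Nat.cast_sum]
      have h1 : ∀ k ∈ bad, (#(V k.1 ×ˢ V k.2) : ℝ) ≤ 2 * n / t * (2 * n / t) := by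
        intro k _
        rw [Finset.card_product, Nat.cast_mul]
        exact mul_le_mul (hVle _) (hVle _) (Nat.cast_nonneg _) (by positivity)
      refine (Finset.sum_le_card_nsmul _ _ _ h1).trans ?_
      rw [nsmul_eq_mul]
      refine (mul_le_mul_of_nonneg_right hbad (by positivity)).trans_eq ?_
      field_simp
      ring
    · refine (Nat.cast_le.2 Finset.card_biUnion_le).trans ?_
      rw [Nat.cast_sum]
      have h1 : ∀ k ∈ ({k : Fin t × Fin t | k.1 < k.2 ∧ k ∉ bad} : Finset (Fin t × Fin t)),
          (#((I k.1 k.2).biUnion fun α => {e ∈ V k.1 ×ˢ V k.2 | ξ k.1 k.2 e = α}) : ℝ) ≤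
            2 * C / ℓ * (#(V k.1) * #(V k.2)) := by
        intro k hk
        have hk := (Finset.mem_filter.1 hk).2
        refine (Nat.cast_le.2 Finset.card_biUnion_le).trans ?_
        rw [Nat.cast_sum]
        refine (Finset.sum_le_card_nsmul _ _ _ fun α _ => hreg k.1 k.2 hk.1 α).trans ?_
        have hIr : (#(I k.1 k.2) : ℝ) ≤ C := by exact_mod_cast hI k.1 k.2 hk.1 hk.2
        rw [nsmul_eq_mul]
        refine (mul_le_mul_of_nonneg_right hIr (by positivity)).trans_eq ?_
        ring
      refine (Finset.sum_le_sum h1).trans ?_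
      refine (Finset.sum_le_sum_of_subset_of_nonneg (Finset.filter_subset _ _)
        fun k _ _ => by positivity).trans_eq ?_
      rw [← Finset.mul_sum, ← Finset.univ_product_univ, Finset.sum_product]
      simp only [← Finset.mul_sum, ← Finset.sum_mul, hsum]
      ring
  have hZc : (#Z : ℝ) ≤ (2 / t + 8 * ε + 4 * C / ℓ) * n ^ 2 := by
    have h1 : #Z ≤ #Z₀ + (#Z₁ + #Z₁) := by
      refine (Finset.card_le_card hZsub).trans ((Finset.card_union_le _ _).trans ?_)
      refine Nat.add_le_add_left ((Finset.card_union_le _ _).trans ?_) _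
      exact Nat.add_le_add_left Finset.card_image_le _
    have h2 : (#Z : ℝ) ≤ #Z₀ + (#Z₁ + #Z₁) := by exact_mod_cast h1
    refine (h2.trans (add_le_add hZ₀c (add_le_add hZ₁c hZ₁c))).trans_eq ?_
    ring
  have hmain := energy_tripCol_sub_le (n := n) hf0 hf1 b (pairLab lab ξ) (Z := Z) ?_
  · refine le_trans ?_ hmain
    have := mul_le_mul_of_nonneg_right hZc hnr
    have h3 : (2 / t + 8 * ε + 4 * C / ℓ) * (n : ℝ) ^ 2 * n * 6 =
        (12 / t + 48 * ε + 24 * C / ℓ) * n ^ 3 := by ring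
    linarith
  · intro p hp q hq hpq
    refine ⟨by simp only [hZ, Finset.mem_filter, hp, hq, hpq, true_and], fun hn => ?_⟩
    have hn' : ¬ P (pairLab lab ξ p) := fun h => hn (Finset.mem_filter.2 ⟨hp, h⟩)
    simp only [hP, not_or, not_exists, not_and] at hn'
    obtain ⟨k, hk⟩ := Option.ne_none_iff_exists'.1 hn'.1
    obtain ⟨p', hpp, hplt, hpk⟩ := exists_of_pairLab_eq_some hk
    obtain ⟨q', hqq, hqlt, hqk⟩ := exists_of_pairLab_eq_some (hpq ▸ hk)
    have hbs : ∀ x x' : ℕ × ℕ, x' = x ∨ x' = x.swap → b x = b x' := by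
      rintro x x' (rfl | rfl)
      · rfl
      · exact (hsymm x).symm
    have hVs : ∀ x x' : ℕ × ℕ, x ∈ range n ×ˢ range n → x' = x ∨ x' = x.swap →
        x' ∈ V (lab x'.1) ×ˢ V (lab x'.2) := by
      rintro x x' hx (rfl | rfl)
      · obtain ⟨h1, h2⟩ := Finset.mem_product.1 hx
        exact Finset.mem_product.2 ⟨hlab _ h1, hlab _ h2⟩
      · obtain ⟨h1, h2⟩ := Finset.mem_product.1 hx
        exact Finset.mem_product.2 ⟨hlab _ h2, hlab _ h1⟩
    rw [hbs p p' hpp, hbs q q' hqq]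
    have heq := hpk.symm.trans hqk
    simp only [Prod.mk.injEq] at heq
    obtain ⟨e1, e2, e3⟩ := heq
    have hgood := hn'.2 _ _ _ (hpk ▸ hk)
    have hq' := hVs q q' hq hqq
    rw [← e1, ← e2] at hq' e3
    exact hpure _ _ hplt hgood.1 p' (hVs p p' hp hpp) q' hq' e3 hgood.2

end PairLab

theorem sum_edgeInd {E : Finset (Finset ℕ)} {S : Finset (ℕ × ℕ × ℕ)}
    (hS : Set.InjOn (fun p : ℕ × ℕ × ℕ => ({p.1, p.2.1, p.2.2} : Finset ℕ)) ↑S) :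
    ∑ p ∈ S, edgeInd E p = #(E ∩ S.image fun p => ({p.1, p.2.1, p.2.2} : Finset ℕ)) := by
  simp only [edgeInd, Finset.sum_boole]
  rw [← Finset.card_image_of_injOn (hS.mono (Finset.coe_subset.2 (Finset.filter_subset
    (fun p : ℕ × ℕ × ℕ => ({p.1, p.2.1, p.2.2} : Finset ℕ) ∈ E) _)))]
  congr 2
  ext e
  simp only [Finset.mem_image, Finset.mem_filter, Finset.mem_inter]
  constructor
  · rintro ⟨p, ⟨hp, hE⟩, rfl⟩
    exact ⟨hE, p, hp, rfl⟩
  · rintro ⟨hE, p, hp, rfl⟩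
    exact ⟨p, ⟨hp, hE⟩, rfl⟩

theorem exists_of_not_strongRegular {δ d : ℝ} {r : ℕ} {E P X Y Z}
    (h : ¬ StrongRegular δ d r E P X Y Z) :
    ∃ Q : Fin r → Finset (Finset ℕ), (∀ i, Q i ⊆ P) ∧ δ * (#(triSets P X Y Z) : ℝ) ≤
      |(#(E ∩ Finset.univ.biUnion fun i => triSets (Q i) X Y Z) : ℝ) -
        d * #(Finset.univ.biUnion fun i => triSets (Q i) X Y Z)| := by
  simp only [StrongRegular, not_forall, not_le] at h
  obtain ⟨Q, hQ, -, -, hdev⟩ := h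
  exact ⟨Q, hQ, hdev.le⟩

section Triad

variable {n t ℓ : ℕ} {V : Fin t → Finset ℕ} {lab : ℕ → Fin t}
  {ξ : Fin t → Fin t → ℕ × ℕ → Fin ℓ}

/-- The bipartite graphs given by a labelling of the pairs crossing a vertex partition. -/
def labGraphs (V : Fin t → Finset ℕ) (ξ : Fin t → Fin t → ℕ × ℕ → Fin ℓ) (i j : Fin t)
    (α : Fin ℓ) : Finset (Finset ℕ) := labGraph (ξ i j) (V i) (V j) α

/-- The indices of a triad. -/
abbrev TriadIdx (t ℓ : ℕ) : Type := (Fin t × Fin t × Fin t) × Fin ℓ × Fin ℓ × Fin ℓ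

/-- The colour of the triangles of a triad. -/
def triadKey (q : TriadIdx t ℓ) : Option (Fin t × Fin t × Fin ℓ) ×
    Option (Fin t × Fin t × Fin ℓ) × Option (Fin t × Fin t × Fin ℓ) :=
  (some (q.1.1, q.1.2.1, q.2.1), some (q.1.1, q.1.2.2, q.2.2.1),
    some (q.1.2.1, q.1.2.2, q.2.2.2))

theorem triadKey_injective : Function.Injective (triadKey (t := t) (ℓ := ℓ)) := by
  rintro ⟨⟨i, j, k⟩, α, β, γ⟩ ⟨⟨i', j', k'⟩, α', β', γ'⟩ h
  simp only [triadKey, Prod.mk.injEq, Option.some.injEq] at h ⊢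
  tauto

theorem labels_of_pairLab {x y : ℕ} {i j : Fin t} {α : Fin ℓ}
    (h : pairLab lab ξ (x, y) = some (i, j, α)) :
    (lab x = i ∧ lab y = j) ∨ (lab x = j ∧ lab y = i) := by
  obtain ⟨q, hq | hq, -, hk⟩ := exists_of_pairLab_eq_some h
  · subst hq
    simp only [Prod.mk.injEq] at hk
    exact Or.inl ⟨hk.1.symm, hk.2.1.symm⟩
  · subst hq
    simp only [Prod.mk.injEq, Prod.swap] at hk
    exact Or.inr ⟨hk.2.1.symm, hk.1.symm⟩

theorem mem_triadG_iff (hV : EquiPart n t V) {i j k : Fin t} (hij : i ≠ j) (hik : i ≠ k)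
    (hjk : j ≠ k) {α β γ : Fin ℓ} {x y z : ℕ} (hx : x ∈ V i) (hy : y ∈ V j) (hz : z ∈ V k) :
    (({x, y} : Finset ℕ) ∈ triadG (labGraphs V ξ) i j k α β γ ↔ ξ i j (x, y) = α) ∧
    (({x, z} : Finset ℕ) ∈ triadG (labGraphs V ξ) i j k α β γ ↔ ξ i k (x, z) = β) ∧
    (({y, z} : Finset ℕ) ∈ triadG (labGraphs V ξ) i j k α β γ ↔ ξ j k (y, z) = γ) := by
  have hno : ∀ {a b : Fin t} {η : Fin ℓ} {u v : ℕ} {c d : Fin t}, u ∈ V c → v ∈ V d →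
      (a ≠ c ∧ a ≠ d ∨ b ≠ c ∧ b ≠ d) → ({u, v} : Finset ℕ) ∉ labGraph (ξ a b) (V a) (V b) η := by
    intro a b η u v c d hu hv hne hmem
    obtain ⟨p, hp, q, hq, -, he⟩ := exists_of_mem_labGraph hmem
    have hp' : p ∈ ({u, v} : Finset ℕ) := he ▸ by simp
    have hq' : q ∈ ({u, v} : Finset ℕ) := he ▸ by simp
    simp only [Finset.mem_insert, Finset.mem_singleton] at hp' hq'
    rcases hne with ⟨h1, h2⟩ | ⟨h1, h2⟩
    · rcases hp' with rfl | rfl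
      · exact h1 (hV.eq_of_mem hp hu)
      · exact h2 (hV.eq_of_mem hp hv)
    · rcases hq' with rfl | rfl
      · exact h1 (hV.eq_of_mem hq hu)
      · exact h2 (hV.eq_of_mem hq hv)
  simp only [triadG, labGraphs, Finset.mem_union]
  refine ⟨?_, ?_, ?_⟩
  · rw [pair_mem_labGraph (hV.disj i j hij) hx hy]
    have h1 := hno (a := i) (b := k) (η := β) hx hy (Or.inr ⟨hik.symm, hjk.symm⟩)
    have h2 := hno (a := j) (b := k) (η := γ) hx hy (Or.inr ⟨hik.symm, hjk.symm⟩)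
    tauto
  · rw [pair_mem_labGraph (hV.disj i k hik) hx hz]
    have h1 := hno (a := i) (b := j) (η := α) hx hz (Or.inr ⟨hij.symm, hjk⟩)
    have h2 := hno (a := j) (b := k) (η := γ) hx hz (Or.inl ⟨hij.symm, hjk⟩)
    tauto
  · rw [pair_mem_labGraph (hV.disj j k hjk) hy hz]
    have h1 := hno (a := i) (b := j) (η := α) hy hz (Or.inl ⟨hij, hik⟩)
    have h2 := hno (a := i) (b := k) (η := β) hy hz (Or.inl ⟨hij, hik⟩)
    tauto

theorem mem_fibre_iff (hV : EquiPart n t V) (hlab : ∀ x ∈ range n, x ∈ V (lab x))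
    {q : TriadIdx t ℓ} (hij : q.1.1 < q.1.2.1) (hjk : q.1.2.1 < q.1.2.2) {p : ℕ × ℕ × ℕ} :
    (p ∈ cube n ∧ tripCol (pairLab lab ξ) p = triadKey q) ↔
      p ∈ V q.1.1 ×ˢ V q.1.2.1 ×ˢ V q.1.2.2 ∧ ({p.1, p.2.1, p.2.2} : Finset ℕ) ∈
        triSets (triadG (labGraphs V ξ) q.1.1 q.1.2.1 q.1.2.2 q.2.1 q.2.2.1 q.2.2.2)
          (V q.1.1) (V q.1.2.1) (V q.1.2.2) := by
  obtain ⟨⟨i, j, k⟩, α, β, γ⟩ := q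
  obtain ⟨x, y, z⟩ := p
  simp only [triadKey, tripCol, Prod.mk.injEq] at hij hjk ⊢
  have hik := hij.trans hjk
  have key : ∀ {a b c : ℕ}, a ∈ V i → b ∈ V j → c ∈ V k →
      lab a = i ∧ lab b = j ∧ lab c = k := fun {a b c} ha hb hc =>
    ⟨((hV.mem_iff_label hlab).1 ha).2, ((hV.mem_iff_label hlab).1 hb).2,
      ((hV.mem_iff_label hlab).1 hc).2⟩
  have hiff : (x, y, z) ∈ V i ×ˢ V j ×ˢ V k →
      ((({x, y, z} : Finset ℕ) ∈ triSets (triadG (labGraphs V ξ) i j k α β γ) (V i) (V j) (V k)) ↔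
      (pairLab lab ξ (x, y) = some (i, j, α) ∧ pairLab lab ξ (x, z) = some (i, k, β) ∧
        pairLab lab ξ (y, z) = some (j, k, γ))) := by
    intro hp
    have := triple_mem_triSets (hV.disj i j hij.ne) (hV.disj i k hik.ne) (hV.disj j k hjk.ne)
      (G := triadG (labGraphs V ξ) i j k α β γ) hp
    rw [this]
    simp only [Finset.mem_product] at hp
    obtain ⟨hx, hy, hz⟩ := hp
    obtain ⟨h1, h2, h3⟩ := mem_triadG_iff (ξ := ξ) hV hij.ne hik.ne hjk.ne (α := α) (β := β)
      (γ := γ) hx hy hz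
    obtain ⟨rfl, rfl, rfl⟩ := key hx hy hz
    rw [h1, h2, h3, pairLab_of_lt (p := (x, y)) hij, pairLab_of_lt (p := (x, z)) hik,
      pairLab_of_lt (p := (y, z)) hjk]
    simp
  constructor
  · rintro ⟨hp, h⟩
    obtain ⟨hxn, hyn, hzn⟩ := mem_cube.1 hp
    have hmem : (x, y, z) ∈ V i ×ˢ V j ×ˢ V k := by
      have h1 := labels_of_pairLab h.1
      have h2 := labels_of_pairLab h.2.1
      have hx : lab x = i := by
        rcases h1 with h1 | h1
        · exact h1.1
        · rcases h2 with h2 | h2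
          · exact h2.1
          · exact absurd (h1.1.symm.trans h2.1) hjk.ne
      have hy : lab y = j := by
        rcases h1 with h1 | h1
        · exact h1.2
        · exact absurd (hx.symm.trans h1.1) hij.ne
      have hz : lab z = k := by
        rcases h2 with h2 | h2
        · exact h2.2
        · exact absurd (hx.symm.trans h2.1) hik.ne
      simp only [Finset.mem_product]
      exact ⟨hx ▸ hlab x hxn, hy ▸ hlab y hyn, hz ▸ hlab z hzn⟩
    exact ⟨hmem, (hiff hmem).2 h⟩
  · rintro ⟨hp, h⟩
    refine ⟨mem_cube.2 ?_, (hiff hp).1 h⟩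
    simp only [Finset.mem_product] at hp
    exact ⟨hV.subset_range _ hp.1, hV.subset_range _ hp.2.1, hV.subset_range _ hp.2.2⟩

/-- If strong regularity fails, then the witnesses of irregularity refine the labelling of
the pairs and increase the energy. -/
theorem exists_energy_gain_of_not_strongReg {δ : ℝ} (hδ : 0 < δ) {r : ℕ} (hV : EquiPart n t V)
    (hlab : ∀ x ∈ range n, x ∈ V (lab x)) {E : Finset (Finset ℕ)}
    (hnot : ¬ StrongRegWrtB δ r E V (labGraphs V ξ) n) :
    ∃ β' : ℕ × ℕ → Option (Fin t × Fin t × Fin ℓ) × (TriadIdx t ℓ × Fin r → Prop),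
      (∀ p : ℕ × ℕ, β' p.swap = β' p) ∧
      (∀ p q, β' p = β' q → pairLab lab ξ p = pairLab lab ξ q) ∧
      energy (cube n) (tripCol (pairLab lab ξ)) (edgeInd E) + δ ^ 3 * n ^ 3 ≤
        energy (cube n) (tripCol β') (edgeInd E) := by
  set φ : ℕ × ℕ × ℕ → Finset ℕ := fun p => {p.1, p.2.1, p.2.2} with hφ
  set tri : TriadIdx t ℓ → Finset (Finset ℕ) → Finset (Finset ℕ) := fun q G =>
    triSets G (V q.1.1) (V q.1.2.1) (V q.1.2.2) with htri
  set P : TriadIdx t ℓ → Finset (Finset ℕ) := fun q =>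
    triadG (labGraphs V ξ) q.1.1 q.1.2.1 q.1.2.2 q.2.1 q.2.2.1 q.2.2.2 with hP
  obtain ⟨bad, hbad, hcard⟩ : ∃ bad : Finset (TriadIdx t ℓ), (∀ q ∈ bad, q.1.1 < q.1.2.1 ∧
      q.1.2.1 < q.1.2.2 ∧ ¬ StrongRegular δ (relDen E (P q) (V q.1.1) (V q.1.2.1) (V q.1.2.2))
        r E (P q) (V q.1.1) (V q.1.2.1) (V q.1.2.2)) ∧
      δ * (n : ℝ) ^ 3 < #(bad.biUnion fun q => tri q (P q)) :=
    ⟨_, fun q hq => (Finset.mem_filter.1 hq).2, not_le.1 hnot⟩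
  have hQ : ∀ q, ∃ Q : Fin r → Finset (Finset ℕ), q ∈ bad → (∀ i, Q i ⊆ P q) ∧
      δ * (#(tri q (P q)) : ℝ) ≤ |(#(E ∩ Finset.univ.biUnion fun i => tri q (Q i)) : ℝ) -
        relDen E (P q) (V q.1.1) (V q.1.2.1) (V q.1.2.2) *
          #(Finset.univ.biUnion fun i => tri q (Q i))| := by
    intro q
    by_cases hq : q ∈ bad
    · obtain ⟨Q, hQ⟩ := exists_of_not_strongRegular (hbad q hq).2.2
      exact ⟨Q, fun _ => hQ⟩
    · exact ⟨fun _ => ∅, fun h => absurd h hq⟩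
  choose Q hQ using hQ
  set β := pairLab lab ξ with hβ
  set inQ : TriadIdx t ℓ → ℕ × ℕ × ℕ → Prop := fun q x => ∃ i : Fin r,
    ({x.1, x.2.1} : Finset ℕ) ∈ Q q i ∧ ({x.1, x.2.2} : Finset ℕ) ∈ Q q i ∧
      ({x.2.1, x.2.2} : Finset ℕ) ∈ Q q i with hinQ
  set W : _ → Finset (ℕ × ℕ × ℕ) := fun k =>
    {x ∈ cube n | tripCol β x = k ∧ ∃ q, triadKey q = k ∧ inQ q x} with hW
  refine ⟨fun p => (β p, fun u => ({p.1, p.2} : Finset ℕ) ∈ Q u.1 u.2), ?_, ?_, ?_⟩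
  · intro p
    simp only [Prod.fst_swap, Prod.snd_swap, hβ, pairLab_swap, Finset.pair_comm p.2 p.1]
  · intro p q h
    exact (Prod.mk.inj h).1
  have hinj : ∀ q ∈ bad, Set.InjOn φ ↑(V q.1.1 ×ˢ V q.1.2.1 ×ˢ V q.1.2.2) := by
    intro q hq
    obtain ⟨h1, h2, -⟩ := hbad q hq
    exact triple_inj (hV.disj _ _ h1.ne) (hV.disj _ _ (h1.trans h2).ne) (hV.disj _ _ h2.ne)
  have hF : ∀ q ∈ bad, ∀ p, p ∈ ({x ∈ cube n | tripCol β x = triadKey q} : Finset _) ↔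
      p ∈ V q.1.1 ×ˢ V q.1.2.1 ×ˢ V q.1.2.2 ∧ φ p ∈ tri q (P q) := by
    intro q hq p
    rw [Finset.mem_filter]
    exact mem_fibre_iff hV hlab (hbad q hq).1 (hbad q hq).2.1
  have hFV : ∀ q ∈ bad, ({x ∈ cube n | tripCol β x = triadKey q} : Finset _) ⊆
      V q.1.1 ×ˢ V q.1.2.1 ×ˢ V q.1.2.2 := fun q hq p hp => ((hF q hq p).1 hp).1
  have hFimage : ∀ q ∈ bad,
      ({x ∈ cube n | tripCol β x = triadKey q} : Finset _).image φ = tri q (P q) := by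
    intro q hq
    ext e
    rw [Finset.mem_image]
    constructor
    · rintro ⟨p, hp, rfl⟩
      exact ((hF q hq p).1 hp).2
    · intro he
      obtain ⟨p, hp, rfl⟩ := Finset.mem_image.1 he
      exact ⟨p, (hF q hq p).2 ⟨(Finset.mem_filter.1 hp).1, he⟩, rfl⟩
  have hFcard : ∀ q ∈ bad, #({x ∈ cube n | tripCol β x = triadKey q} : Finset _) =
      #(tri q (P q)) := by
    intro q hq
    rw [← hFimage q hq, Finset.card_image_of_injOn
      ((hinj q hq).mono (Finset.coe_subset.2 (hFV q hq)))]
  have hWF : ∀ k, W k ⊆ ({x ∈ cube n | tripCol β x = k} : Finset _) := fun k x hx =>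
    Finset.mem_filter.2 ⟨(Finset.mem_filter.1 hx).1, (Finset.mem_filter.1 hx).2.1⟩
  have hWimage : ∀ q ∈ bad, (W (triadKey q)).image φ =
      Finset.univ.biUnion fun i => tri q (Q q i) := by
    intro q hq
    obtain ⟨h1, h2, -⟩ := hbad q hq
    have hmem : ∀ {p G}, p ∈ V q.1.1 ×ˢ V q.1.2.1 ×ˢ V q.1.2.2 → (φ p ∈ tri q G ↔ _) :=
      fun {p G} hp => triple_mem_triSets (hV.disj _ _ h1.ne) (hV.disj _ _ (h1.trans h2).ne)
        (hV.disj _ _ h2.ne) (G := G) hp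
    ext e
    simp only [Finset.mem_image, Finset.mem_biUnion, Finset.mem_univ, true_and]
    constructor
    · rintro ⟨p, hp, rfl⟩
      have hpV := hFV q hq (hWF _ hp)
      obtain ⟨-, -, q', hq', i, hi⟩ := Finset.mem_filter.1 hp
      obtain rfl := triadKey_injective hq'
      exact ⟨i, (hmem hpV).2 hi⟩
    · rintro ⟨i, he⟩
      obtain ⟨p, hp, rfl⟩ := Finset.mem_image.1 he
      obtain ⟨hpV, hpQ⟩ := Finset.mem_filter.1 hp
      have hsub := (hQ q hq).1 i
      have hpF := (hF q hq p).2
        ⟨hpV, (hmem hpV).2 ⟨hsub hpQ.1, hsub hpQ.2.1, hsub hpQ.2.2⟩⟩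
      obtain ⟨hpc, hpk⟩ := Finset.mem_filter.1 hpF
      exact ⟨p, Finset.mem_filter.2 ⟨hpc, hpk, q, rfl, i, hpQ⟩, rfl⟩
  have key := energy_add_le_of_witness (Ω := cube n) (c := tripCol β)
    (c' := tripCol fun p : ℕ × ℕ => (β p, fun u : TriadIdx t ℓ × Fin r =>
      ({p.1, p.2} : Finset ℕ) ∈ Q u.1 u.2)) (f := edgeInd E) hδ.le (bad.image triadKey) W
    (fun k _ => by convert hWF k) ?_ ?_
  · refine le_trans ?_ key
    have h1 : δ * (n : ℝ) ^ 3 ≤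
        ∑ k ∈ bad.image triadKey, (#{x ∈ cube n | tripCol β x = k} : ℝ) := by
      rw [Finset.sum_image fun x _ y _ h => triadKey_injective h]
      refine hcard.le.trans ?_
      have h2 : #(bad.biUnion fun q => tri q (P q)) ≤
          ∑ q ∈ bad, #{x ∈ cube n | tripCol β x = triadKey q} :=
        Finset.card_biUnion_le.trans_eq (Finset.sum_congr rfl fun q hq => (hFcard q hq).symm)
      exact_mod_cast h2
    have h2 := mul_le_mul_of_nonneg_left h1 (sq_nonneg δ)
    have h3 : δ ^ 2 * (δ * (n : ℝ) ^ 3) = δ ^ 3 * n ^ 3 := by ring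
    rw [h3] at h2
    refine (add_le_add_right h2 _).trans (le_of_eq ?_)
    congr!
  · intro k hk
    obtain ⟨q, hq, rfl⟩ := Finset.mem_image.1 hk
    have hconst : ∀ x ∈ W (triadKey q), fibAvg (cube n) (tripCol β) (edgeInd E) x =
        relDen E (P q) (V q.1.1) (V q.1.2.1) (V q.1.2.2) := by
      intro x hx
      have hxk := (Finset.mem_filter.1 (hWF _ hx)).2
      rw [fibAvg, hxk]
      have e1 := sum_edgeInd (E := E) ((hinj q hq).mono (Finset.coe_subset.2 (hFV q hq)))
      have e2 := hFcard q hq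
      rw [hFimage q hq] at e1
      rw [relDen, ← Nat.cast_inj (R := ℝ).2 e2, ← e1]
    have hWinj := (hinj q hq).mono (Finset.coe_subset.2 ((hWF _).trans (hFV q hq)))
    have e3 := sum_edgeInd (E := E) hWinj
    have e4 := Finset.card_image_of_injOn hWinj
    rw [hWimage q hq] at e3 e4
    rw [Finset.sum_sub_distrib, Finset.sum_congr rfl hconst, Finset.sum_const, nsmul_eq_mul,
      mul_comm (#(W (triadKey q)) : ℝ), e3, ← e4]
    convert (hQ q hq).2
    exact hFcard q hq
  · intro x hx y hy hxy
    simp only [tripCol, Prod.mk.injEq] at hxy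
    obtain ⟨⟨a1, a2⟩, ⟨b1, b2⟩, c1, c2⟩ := hxy
    have hxy' : tripCol β x = tripCol β y := by simp only [tripCol, a1, b1, c1]
    refine ⟨hxy', ?_⟩
    simp only [hW, Finset.mem_filter, hx, hy, true_and, hxy', hinQ]
    refine exists_congr fun q => and_congr_right fun _ => exists_congr fun i => ?_
    rw [congrFun a2 (q, i), congrFun b2 (q, i), congrFun c2 (q, i)]

end Triad

/-- Regular splittings of all the pairs of a vertex partition. -/
theorem exists_regular_splits {t C ℓ : ℕ} (hℓ : 0 < ℓ) {δ ε : ℝ} (hδ : 0 < δ) (hδ1 : δ ≤ 1)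
    (hε : C * ε ≤ δ / 2) {V : Fin t → Finset ℕ}
    (hlarge : ∀ i j, 16 * ((#(V i) : ℝ) + #(V j) + 1 + ℓ) ≤ δ ^ 2 * (#(V i) * #(V j)))
    {b : ℕ × ℕ → ℕ} (hb : ∀ e, b e < C) :
    ∃ (ξ : Fin t → Fin t → ℕ × ℕ → Fin ℓ) (I : Fin t → Fin t → Finset (Fin ℓ)),
      (∀ i j α, ∀ X' ⊆ V i, ∀ Y' ⊆ V j,
        |(#{e ∈ X' ×ˢ Y' | ξ i j e = α} : ℝ) - 1 / ℓ * (#X' * #Y')| ≤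
          δ * (#(V i) * #(V j))) ∧
      ∀ i j, PairReg ε b (V i) (V j) → #(I i j) ≤ C ∧
        ∀ e ∈ V i ×ˢ V j, ∀ e' ∈ V i ×ˢ V j, ξ i j e = ξ i j e' → ξ i j e ∉ I i j → b e = b e' := by
  have key : ∀ i j, ∃ (ξ : ℕ × ℕ → Fin ℓ) (I : Finset (Fin ℓ)),
      (∀ α, ∀ X' ⊆ V i, ∀ Y' ⊆ V j,
        |(#{e ∈ X' ×ˢ Y' | ξ e = α} : ℝ) - 1 / ℓ * (#X' * #Y')| ≤ δ * (#(V i) * #(V j))) ∧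
      (PairReg ε b (V i) (V j) → #I ≤ C ∧
        ∀ e ∈ V i ×ˢ V j, ∀ e' ∈ V i ×ˢ V j, ξ e = ξ e' → ξ e ∉ I → b e = b e') := by
    intro i j
    by_cases h : PairReg ε b (V i) (V j)
    · obtain ⟨ξ, h1, I, h2, h3⟩ := exists_regular_split hℓ hδ hδ1 hε (hlarge i j) hb h
      exact ⟨ξ, I, h1, fun _ => ⟨h2, h3⟩⟩
    · obtain ⟨ξ, h1, -⟩ := exists_regular_split (C := 1) (ε := 0) hℓ hδ hδ1
        (by rw [mul_zero]; positivity) (hlarge i j) (b := fun _ => 0) (fun _ => one_pos)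
        (pairReg_zero _ _)
      exact ⟨ξ, ∅, h1, fun h' => absurd h' h⟩
  choose ξ I h1 h2 using key
  exact ⟨ξ, I, h1, h2⟩

theorem card_not_pairReg_le {t : ℕ} (ht : 0 < t) {V : Fin t → Finset ℕ}
    (hne : ∀ i, (V i).Nonempty) {C : ℕ} {b : ℕ × ℕ → ℕ} (hb : ∀ e, b e < C) {ε : ℝ} (hε : 0 ≤ ε)
    (bad : Finset (Fin t × Fin t × Fin t)) (hcard : (#bad : ℝ) ≤ ε * t ^ 3)
    (hbad : ∀ k, k ∉ bad → ∀ c : Fin C,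
      TriReg ε (fun p => if b (p.1, p.2.1) = c then 1 else 0) (V k.1) (V k.2.1) (V k.2.2)) :
    (#{k : Fin t × Fin t | ¬ PairReg ε b (V k.1) (V k.2)} : ℝ) ≤ ε * t ^ 2 := by
  have htr : (0 : ℝ) < t := by exact_mod_cast ht
  have h : #{k : Fin t × Fin t | ¬ PairReg ε b (V k.1) (V k.2)} * t ≤ #bad := by
    have hprod : #{k : Fin t × Fin t | ¬ PairReg ε b (V k.1) (V k.2)} * t =
        #((Finset.univ.filter fun k : Fin t × Fin t => ¬ PairReg ε b (V k.1) (V k.2)) ×ˢ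
          (Finset.univ : Finset (Fin t))) := by
      rw [Finset.card_product, Finset.card_univ, Fintype.card_fin]
    rw [hprod]
    refine Finset.card_le_card_of_injOn (fun x => (x.1.1, x.1.2, x.2)) ?_ ?_
    · rintro ⟨⟨i, j⟩, k⟩ hx
      have hx' := (Finset.mem_filter.1 (Finset.mem_product.1 hx).1).2
      by_contra hk
      refine hx' (PairReg.of_triReg (hne k) fun c => ?_)
      by_cases hc : c < C
      · exact hbad _ hk ⟨c, hc⟩
      · have h0 : ∀ p : ℕ × ℕ × ℕ, (if b (p.1, p.2.1) = c then (1 : ℝ) else 0) = 0 := fun p =>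
          if_neg fun hp : b (p.1, p.2.1) = c => hc (hp ▸ hb _)
        intro X' _ Y' _ Z' _
        simp only [h0, Finset.sum_const_zero, zero_div, zero_mul, sub_zero, abs_zero]
        positivity
    · rintro ⟨⟨i, j⟩, k⟩ _ ⟨⟨i', j'⟩, k'⟩ _ h
      simpa [and_assoc] using h
  have h' : (#{k : Fin t × Fin t | ¬ PairReg ε b (V k.1) (V k.2)} : ℝ) * t ≤ ε * t ^ 2 * t := by
    calc _ ≤ (#bad : ℝ) := by exact_mod_cast h
      _ ≤ _ := hcard.trans_eq (by ring)
  exact le_of_mul_le_mul_right h' htr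

theorem pow_three_le_choose_three {t : ℕ} (ht : 4 ≤ t) : (t : ℝ) ^ 3 ≤ 16 * t.choose 3 := by
  have h1 : (4 : ℝ) ≤ t := by exact_mod_cast ht
  have h2 : (t.choose 3 : ℝ) = t * (t - 1) * (t - 2) / 6 := by
    rw [Nat.cast_choose_eq_descPochhammer_div, descPochhammer_eval_eq_prod_range]
    simp [Finset.prod_range_succ, Nat.factorial]
  rw [h2]
  nlinarith [mul_nonneg (by linarith : (0 : ℝ) ≤ t) (by linarith : (0 : ℝ) ≤ t - 4),
    mul_nonneg (mul_nonneg (by linarith : (0 : ℝ) ≤ t) (by linarith : (0 : ℝ) ≤ t - 4))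
      (by linarith : (0 : ℝ) ≤ t - 4)]

theorem weakRegWrt_of_triReg {n t : ℕ} (ht : 4 ≤ t) {V : Fin t → Finset ℕ} (hV : EquiPart n t V)
    {δ ε : ℝ} (hδ : 0 ≤ δ) (hεδ : ε ≤ δ / 16) {E : Finset (Finset ℕ)}
    (bad : Finset (Fin t × Fin t × Fin t)) (hcard : (#bad : ℝ) ≤ ε * t ^ 3)
    (hbad : ∀ k, k ∉ bad → TriReg ε (edgeInd E) (V k.1) (V k.2.1) (V k.2.2)) :
    WeakRegWrt δ E V := by
  have hsub : #{x : Fin t × Fin t × Fin t | x.1 < x.2.1 ∧ x.2.1 < x.2.2 ∧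
      ¬ WeakRegular δ E (V x.1) (V x.2.1) (V x.2.2)} ≤ #bad := by
    refine Finset.card_le_card fun x hx => ?_
    obtain ⟨-, h1, h2, h3⟩ := Finset.mem_filter.1 hx
    by_contra hk
    exact h3 ((hbad x hk).weakRegular (by linarith) (hV.disj _ _ h1.ne)
      (hV.disj _ _ (h1.trans h2).ne) (hV.disj _ _ h2.ne))
  have h1 : (#{x : Fin t × Fin t × Fin t | x.1 < x.2.1 ∧ x.2.1 < x.2.2 ∧
      ¬ WeakRegular δ E (V x.1) (V x.2.1) (V x.2.2)} : ℝ) ≤ #bad := by exact_mod_cast hsub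
  have h2 : δ / 16 * (t : ℝ) ^ 3 ≤ δ * t.choose 3 := by
    calc δ / 16 * (t : ℝ) ^ 3 ≤ δ / 16 * (16 * t.choose 3) := by
          gcongr
          exact pow_three_le_choose_three ht
      _ = _ := by ring
  have h3 : ε * (t : ℝ) ^ 3 ≤ δ / 16 * (t : ℝ) ^ 3 := by gcongr
  unfold WeakRegWrt
  convert (h1.trans hcard).trans (h3.trans h2)

/-- The number of colours needed to refine the labelling of the pairs by witnesses of
irregularity. -/
noncomputable def witnessColours (t ℓ r : ℕ) : ℕ :=
  Fintype.card (Option (Fin t × Fin t × Fin ℓ) × (TriadIdx t ℓ × Fin r → Prop))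

theorem exists_sum_energy_gain_of_not_strongReg {n t ℓ s r : ℕ} {V : Fin t → Finset ℕ}
    (hV : EquiPart n t V) {lab : ℕ → Fin t} (hlab : ∀ x ∈ range n, x ∈ V (lab x))
    {ξ : Fin t → Fin t → ℕ × ℕ → Fin ℓ} {δ : ℝ} (hδ : 0 < δ) {Hs : Fin s → Finset (Finset ℕ)}
    {m : Fin s} (hnot : ¬ StrongRegWrtB δ r (Hs m) V (labGraphs V ξ) n) :
    ∃ b : ℕ × ℕ → ℕ, (∀ p, b p < witnessColours t ℓ r) ∧ (∀ p : ℕ × ℕ, b p.swap = b p) ∧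
      ∑ m, energy (cube n) (tripCol (pairLab lab ξ)) (edgeInd (Hs m)) + δ ^ 3 * n ^ 3 ≤
        ∑ m, energy (cube n) (tripCol b) (edgeInd (Hs m)) := by
  obtain ⟨β, h1, h2, h3⟩ := exists_energy_gain_of_not_strongReg hδ hV hlab hnot
  refine ⟨fun p => Fintype.equivFin _ (β p), fun p => Fin.is_lt _, fun p => by simp [h1], ?_⟩
  have hβ : ∀ m', energy (cube n) (tripCol β) (edgeInd (Hs m')) ≤ energy (cube n)
      (tripCol fun p => (Fintype.equivFin _ (β p) : ℕ)) (edgeInd (Hs m')) := fun m' =>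
    energy_mono_of_refines (edgeInd_nonneg _) (edgeInd_le_one _) fun x _ y _ hxy => by
      simpa [tripCol, ← Fin.ext_iff] using hxy
  have hlabβ : ∀ m', energy (cube n) (tripCol (pairLab lab ξ)) (edgeInd (Hs m')) ≤
      energy (cube n) (tripCol β) (edgeInd (Hs m')) := fun m' =>
    energy_mono_of_refines (edgeInd_nonneg _) (edgeInd_le_one _) fun x _ y _ hxy => by
      simp only [tripCol, Prod.mk.injEq] at hxy ⊢
      exact ⟨h2 _ _ hxy.1, h2 _ _ hxy.2.1, h2 _ _ hxy.2.2⟩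
  rw [← Finset.add_sum_erase _ _ (Finset.mem_univ m),
    ← Finset.add_sum_erase Finset.univ (fun m => energy (cube n) (tripCol fun p =>
      (Fintype.equivFin _ (β p) : ℕ)) (edgeInd (Hs m))) (Finset.mem_univ m)]
  have h4 := Finset.sum_le_sum fun m' (_ : m' ∈ Finset.univ.erase m) =>
    (hlabβ m').trans (hβ m')
  have h5 := h3.trans (hβ m)
  linarith

/-- The conclusion of the regularity lemma, with the bound `T` on the sizes of the partitions. -/
def GraphLikeRegular {s : ℕ} (δ₃ : ℝ) (δ₂ : ℕ → ℝ) (r : ℕ → ℕ → ℕ) (ℓ₀ t₀ T n : ℕ)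
    (Hs : Fin s → Finset (Finset ℕ)) : Prop :=
  ∃ t ℓ : ℕ, t₀ ≤ t ∧ t ≤ T ∧ ℓ₀ ≤ ℓ ∧ ℓ ≤ T ∧ ∃ (V : Fin t → Finset ℕ)
    (ξ : Fin t → Fin t → ℕ × ℕ → Fin ℓ), EquiPart n t V ∧
    (∀ i j, i ≠ j → ∀ α, BipRegular (δ₂ ℓ) (1 / (ℓ : ℝ)) (labGraphs V ξ i j α) (V i) (V j)) ∧
    (∀ m, WeakRegWrt (δ₂ ℓ) (Hs m) V) ∧
    ∀ m, StrongRegWrtB δ₃ (r t ℓ) (Hs m) V (labGraphs V ξ) n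

/-- A colouring of the pairs with few colours and large energy. -/
def HasPairEnergy {s : ℕ} (n : ℕ) (Hs : Fin s → Finset (Finset ℕ)) (C : ℕ) (q : ℝ) : Prop :=
  ∃ b : ℕ × ℕ → ℕ, (∀ p, b p < C) ∧ (∀ p : ℕ × ℕ, b p.swap = b p) ∧
    q * n ^ 3 ≤ ∑ m, energy (cube n) (tripCol b) (edgeInd (Hs m))

theorem exists_nat_pos_div_le {a η : ℝ} (ha : 0 ≤ a) (hη : 0 < η) (k : ℕ) :
    ∃ m : ℕ, k ≤ m ∧ 0 < m ∧ ∀ m', m ≤ m' → a / (m' : ℝ) ≤ η := by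
  obtain ⟨m, hm⟩ := exists_nat_ge (a / η)
  refine ⟨max k (m + 1), le_max_left _ _, by positivity, fun m' hm' => ?_⟩
  have h1 : (m : ℝ) + 1 ≤ m' := by exact_mod_cast (le_max_right _ _).trans hm'
  have h2 : (0 : ℝ) < m' := by linarith [(Nat.cast_nonneg m : (0 : ℝ) ≤ m)]
  rw [div_le_iff₀ h2]
  rw [div_le_iff₀ hη] at hm
  nlinarith

theorem large_of_le {δ K x y : ℝ} {ℓ : ℕ} (hδ : 0 < δ) (hK : 16 * (3 + ℓ) / δ ^ 2 ≤ K)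
    (hK1 : 1 ≤ K) (hx : K ≤ x) (hy : K ≤ y) :
    16 * (x + y + 1 + ℓ) ≤ δ ^ 2 * (x * y) := by
  rw [div_le_iff₀ (by positivity)] at hK
  have hl : (0 : ℝ) ≤ ℓ := Nat.cast_nonneg ℓ
  have hxy : x + y + 1 + ℓ ≤ (3 + ℓ) * max x y := by
    have h1 := le_max_left x y
    have h2 := le_max_right x y
    nlinarith [mul_nonneg hl (by linarith : (0 : ℝ) ≤ max x y - 1)]
  have hmin : K ≤ min x y := le_min hx hy
  have hmax : 0 ≤ max x y := by linarith [le_max_left x y]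
  calc 16 * (x + y + 1 + ℓ) ≤ 16 * ((3 + ℓ) * max x y) := by gcongr
    _ = 16 * (3 + ℓ) * max x y := by ring
    _ ≤ K * δ ^ 2 * max x y := by gcongr
    _ ≤ min x y * δ ^ 2 * max x y := by gcongr
    _ = δ ^ 2 * (min x y * max x y) := by ring
    _ = _ := by rw [min_mul_max]

/-- Either the regularity lemma holds or the energy can be increased. -/
theorem graphLikeRegular_or_energy_step {δ₃ : ℝ} (hδ₃ : 0 < δ₃) {δ₂ : ℕ → ℝ}
    (hδ₂ : ∀ ℓ, 0 < δ₂ ℓ ∧ δ₂ ℓ ≤ 1) (r : ℕ → ℕ → ℕ) (ℓ₀ t₀ s C : ℕ) :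
    ∃ C' T n₀ : ℕ, ∀ n, n₀ ≤ n → ∀ Hs : Fin s → Finset (Finset ℕ), ∀ q,
      HasPairEnergy n Hs C q → GraphLikeRegular δ₃ δ₂ r ℓ₀ t₀ T n Hs ∨
        HasPairEnergy n Hs C' (q + δ₃ ^ 3 / 2) := by
  have hη : 0 < δ₃ ^ 3 / 6 := by positivity
  obtain ⟨ℓ, hℓ₀, hℓ, hℓC⟩ := exists_nat_pos_div_le (a := s * (24 * C)) (by positivity) hη ℓ₀
  obtain ⟨t₁, ht₁0, ht₁, ht₁s⟩ := exists_nat_pos_div_le (a := s * 12) (by positivity) hη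
    (max t₀ 4)
  have hℓr : (0 : ℝ) < ℓ := by exact_mod_cast hℓ
  set δ : ℝ := min (δ₂ ℓ) (1 / ℓ) with hδdef
  have hδ : 0 < δ := lt_min (hδ₂ ℓ).1 (by positivity)
  have hδ1 : δ ≤ 1 := (min_le_left _ _).trans (hδ₂ ℓ).2
  set ε : ℝ := min (δ / 16) (min (δ / 2 / (C + 1)) (δ₃ ^ 3 / 6 / (48 * (s + 1)))) with hεdef
  have hε : 0 < ε := by
    refine lt_min (by positivity) (lt_min (by positivity) (by positivity))
  have hε16 : ε ≤ δ / 16 := min_le_left _ _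
  have hεC : C * ε ≤ δ / 2 := by
    have h1 : ε ≤ δ / 2 / (C + 1) := (min_le_right _ _).trans (min_le_left _ _)
    rw [le_div_iff₀ (by positivity)] at h1
    nlinarith
  have hεs : s * (48 * ε) ≤ δ₃ ^ 3 / 6 := by
    have h1 : ε ≤ δ₃ ^ 3 / 6 / (48 * (s + 1)) := (min_le_right _ _).trans (min_le_right _ _)
    rw [le_div_iff₀ (by positivity)] at h1
    nlinarith
  obtain ⟨T, n₀, hweak⟩ := weak_regularity (A := Fin s ⊕ Fin C) hε t₁
  obtain ⟨K, hK⟩ := exists_nat_ge (16 * (3 + ℓ) / δ ^ 2)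
  refine ⟨(range (T + 1)).sup fun t => witnessColours t ℓ (r t ℓ), max T ℓ,
    max n₀ (2 * T * (K + 1)), ?_⟩
  rintro n hn Hs q ⟨b, hb, hsymm, hq⟩
  obtain ⟨t, V, ht, htT, hV, hbad⟩ := hweak n ((le_max_left _ _).trans hn)
    (Sum.elim (fun m => edgeInd (Hs m)) fun c p => if b (p.1, p.2.1) = c then 1 else 0)
    (by
      rintro (m | c) x
      · exact edgeInd_nonneg _ _
      · simp only [Sum.elim_inr]
        split_ifs <;> norm_num)
    (by
      rintro (m | c) x
      · exact edgeInd_le_one _ _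
      · simp only [Sum.elim_inr]
        split_ifs <;> norm_num)
  have ht4 : 4 ≤ t := (le_max_right _ _).trans (ht₁0.trans ht)
  have htpos : 0 < t := by omega
  have htr : (0 : ℝ) < t := by exact_mod_cast htpos
  have hKn : 2 * t * (K + 1) ≤ n :=
    (Nat.mul_le_mul_right _ (Nat.mul_le_mul_left _ htT)).trans ((le_max_right _ _).trans hn)
  have h2t : 2 * t ≤ n := (Nat.le_mul_of_pos_right _ (by omega)).trans hKn
  have hVK : ∀ i, (K : ℝ) + 1 ≤ #(V i) := fun i => by
    refine le_trans ?_ (hV.half_le_card htpos h2t i)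
    rw [le_div_iff₀ (by positivity)]
    have : (2 * t * (K + 1) : ℝ) ≤ n := by exact_mod_cast hKn
    linarith
  have hne : ∀ i, (V i).Nonempty := fun i => by
    rw [← Finset.card_pos]
    have := hVK i
    have h0 : (0 : ℝ) < #(V i) := by 
      linarith [(Nat.cast_nonneg K : (0 : ℝ) ≤ K)]
    exact_mod_cast h0
  obtain ⟨lab, hlab⟩ := hV.exists_label htpos
  obtain ⟨ξ, I, hξ, hI⟩ := exists_regular_splits hℓ hδ hδ1 hεC (V := V)
    (fun i j => large_of_le hδ (hK.trans (by linarith)) (by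
      linarith [(Nat.cast_nonneg K : (0 : ℝ) ≤ K)]) (hVK i) (hVK j)) hb
  set bad : Finset (Fin t × Fin t × Fin t) := {k | ∃ a, ¬ TriReg ε (Sum.elim
    (fun m => edgeInd (Hs m)) (fun (c : Fin C) p => if b (p.1, p.2.1) = c then 1 else 0) a)
      (V k.1) (V k.2.1) (V k.2.2)} with hbaddef
  have hgood : ∀ k, k ∉ bad → ∀ a, TriReg ε (Sum.elim (fun m => edgeInd (Hs m))
      (fun (c : Fin C) p => if b (p.1, p.2.1) = c then 1 else 0) a)
      (V k.1) (V k.2.1) (V k.2.2) := fun k hk a => by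
    by_contra h
    exact hk (Finset.mem_filter.2 ⟨Finset.mem_univ _, a, h⟩)
  have hpairs := card_not_pairReg_le htpos hne hb hε.le bad hbad
    fun k hk c => by
      have := hgood k hk (Sum.inr c)
      simpa only [Sum.elim_inr] using this
  by_cases hstrong : ∀ m, StrongRegWrtB δ₃ (r t ℓ) (Hs m) V (labGraphs V ξ) n
  · refine Or.inl ⟨t, ℓ, (le_max_left _ _).trans (ht₁0.trans ht), htT.trans (le_max_left _ _), hℓ₀,
      le_max_right _ _, V, ξ, hV, fun i j hij α X' hX' Y' hY' => ?_, fun m => ?_, hstrong⟩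
    · rw [labGraphs, e2_labGraph (hV.disj i j hij) hX' hY', mul_assoc, mul_assoc]
      refine (hξ i j α X' hX' Y' hY').trans ?_
      gcongr
      exact min_le_left _ _
    · refine weakRegWrt_of_triReg ht4 hV (hδ₂ ℓ).1.le (hε16.trans ?_) bad hbad
        fun k hk => hgood k hk (Sum.inl m)
      gcongr
      exact min_le_left _ _
  · right
    push Not at hstrong
    obtain ⟨m, hm⟩ := hstrong
    obtain ⟨b', hb', hsymm', hgain⟩ := exists_sum_energy_gain_of_not_strongReg hV hlab hδ₃ hm
    refine ⟨b', fun p => (hb' p).trans_le (Finset.le_sup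
      (f := fun t => witnessColours t ℓ (r t ℓ)) (Finset.mem_range.2 (by omega))), hsymm', ?_⟩
    have hloss : ∀ m, energy (cube n) (tripCol b) (edgeInd (Hs m)) -
        (12 / t + 48 * ε + 24 * C / ℓ) * n ^ 3 ≤
        energy (cube n) (tripCol (pairLab lab ξ)) (edgeInd (Hs m)) := fun m =>
      energy_pairLab_sub_le hV htpos (by omega) hlab hsymm _ hpairs I
        (fun i j _ hij => (hI i j (by simpa using hij)).1)
        (fun i j _ α => by
          have h1 := (abs_le.1 (hξ i j α _ subset_rfl _ subset_rfl)).2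
          have h2 : δ * ((#(V i) : ℝ) * #(V j)) ≤ 1 / ℓ * (#(V i) * #(V j)) := by
            gcongr
            exact min_le_right _ _
          have h3 : (2 / ℓ : ℝ) * (#(V i) * #(V j)) =
              1 / ℓ * (#(V i) * #(V j)) + 1 / ℓ * (#(V i) * #(V j)) := by ring
          linarith)
        (fun i j _ hij => (hI i j (by simpa using hij)).2)
        (edgeInd_nonneg _) (edgeInd_le_one _)
    have hsum := Finset.sum_le_sum fun m (_ : m ∈ Finset.univ) => hloss m
    rw [Finset.sum_sub_distrib, Finset.sum_const, nsmul_eq_mul, Finset.card_univ,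
      Fintype.card_fin] at hsum
    have hsmall : s * ((12 / t + 48 * ε + 24 * C / ℓ) * (n : ℝ) ^ 3) ≤ δ₃ ^ 3 / 2 * n ^ 3 := by
      have h1 := ht₁s t ht
      have h2 := hℓC ℓ le_rfl
      rw [← mul_assoc]
      refine mul_le_mul_of_nonneg_right ?_ (by positivity)
      rw [mul_div_assoc] at h1 h2
      linarith
    linarith

/-- The regularity lemma with all the conclusions packaged together. -/
theorem exists_graphLikeRegular {δ₃ : ℝ} (hδ₃ : 0 < δ₃) {δ₂ : ℕ → ℝ}
    (hδ₂ : ∀ ℓ, 0 < δ₂ ℓ ∧ δ₂ ℓ ≤ 1) (r : ℕ → ℕ → ℕ) (ℓ₀ t₀ s : ℕ) :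
    ∃ T n₀ : ℕ, 0 < n₀ ∧ ∀ n, n₀ ≤ n → ∀ Hs : Fin s → Finset (Finset ℕ),
      GraphLikeRegular δ₃ δ₂ r ℓ₀ t₀ T n Hs := by
  obtain ⟨T, n₀, h⟩ := energy_iteration
    (O := {o : ℕ × (Fin s → Finset (Finset ℕ)) // 0 < o.1}) (fun o => o.1.1)
    (fun T o => GraphLikeRegular δ₃ δ₂ r ℓ₀ t₀ T o.1.1 o.1.2)
    (fun T T' o hT ⟨t, ℓ, h1, h2, h3, h4, h5⟩ =>
      ⟨t, ℓ, h1, h2.trans hT, h3, h4.trans hT, h5⟩)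
    (fun C q o => HasPairEnergy o.1.1 o.1.2 C q) (η := δ₃ ^ 3 / 2) (M := s) (by positivity) 1 0 0
    (fun o _ => Or.inr ⟨fun _ => 0, fun _ => one_pos, fun _ => rfl, by
      rw [zero_mul]
      exact Finset.sum_nonneg fun _ _ => energy_nonneg⟩)
    (fun C => by
      obtain ⟨C', T, n₀, h⟩ := graphLikeRegular_or_energy_step hδ₃ hδ₂ r ℓ₀ t₀ s C
      exact ⟨C', T, n₀, fun o ho q hq => h o.1.1 ho o.1.2 q hq⟩)
    (fun C q o ⟨b, _, _, hq⟩ => by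
      have h1 : ∑ m, energy (cube o.1.1) (tripCol b) (edgeInd (o.1.2 m)) ≤
          ∑ _m : Fin s, (o.1.1 : ℝ) ^ 3 := Finset.sum_le_sum fun m _ => by
        rw [← card_cube]
        exact energy_le_card (edgeInd_nonneg _) (edgeInd_le_one _)
      rw [Finset.sum_const, nsmul_eq_mul, Finset.card_univ, Fintype.card_fin] at h1
      have h2 : (0 : ℝ) < (o.1.1 : ℝ) ^ 3 := by
        have := o.2
        positivity
      exact le_of_mul_le_mul_right (hq.trans h1) h2)
  exact ⟨T, max n₀ 1, by positivity, fun n hn Hs =>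
    h ⟨(n, Hs), (le_max_right _ _).trans hn⟩ ((le_max_left _ _).trans hn)⟩

/-- (Strong Graph-Like Regularity Lemma for 3-graphs.) -/
theorem strong_graphlike_regularity (δ₃ : ℝ) (hδ₃ : 0 < δ₃) (δ₂ : ℕ → ℝ)
    (hδ₂ : ∀ ℓ, 0 < δ₂ ℓ ∧ δ₂ ℓ ≤ 1) (r : ℕ → ℕ → ℕ) (ℓ₀ t₀ s : ℕ)
    (hℓ₀ : 0 < ℓ₀) (ht₀ : 0 < t₀) (hs : 0 < s) :
    ∃ n₀ T : ℕ, 0 < n₀ ∧ 0 < T ∧ ∀ n : ℕ, n₀ ≤ n →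
      ∀ Hs : Fin s → Finset (Finset ℕ),
        (∀ i, ∀ e ∈ Hs i, e ⊆ Finset.range n ∧ e.card = 3) →
        ∃ t ℓ : ℕ, t₀ ≤ t ∧ t ≤ T ∧ ℓ₀ ≤ ℓ ∧ ℓ ≤ T ∧
          ∃ V : Fin t → Finset ℕ, ∃ B : Fin t → Fin t → Fin ℓ → Finset (Finset ℕ),
            -- `V` is a partition of `[n]`
            ((Finset.univ : Finset (Fin t)).biUnion V = Finset.range n) ∧
            (∀ i j : Fin t, i ≠ j → Disjoint (V i) (V j)) ∧
            -- (R.1) the parts are sorted by size and equitable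
            (∀ i j : Fin t, i ≤ j → (V i).card ≤ (V j).card) ∧
            (∀ i j : Fin t, (V j).card ≤ (V i).card + 1) ∧
            -- `B` is an `ℓ`-equitable partition of `K^(2)(V)`
            (∀ i j : Fin t, i < j →
              (∀ α β : Fin ℓ, α ≠ β → Disjoint (B i j α) (B i j β)) ∧
              (Finset.univ.biUnion (B i j) = K2 (V i) (V j))) ∧
            -- (R.2)
            (∀ i j : Fin t, i < j → ∀ α : Fin ℓ,
              BipRegular (δ₂ ℓ) (1 / (ℓ : ℝ)) (B i j α) (V i) (V j)) ∧
            -- (R.3)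
            (∀ m : Fin s, WeakRegWrt (δ₂ ℓ) (Hs m) V) ∧
            -- (R.4)
            (∀ m : Fin s, StrongRegWrtB δ₃ (r t ℓ) (Hs m) V B n) := by
  obtain ⟨T, n₀, hn₀, h⟩ := exists_graphLikeRegular hδ₃ hδ₂ r ℓ₀ t₀ s
  refine ⟨n₀, max T 1, hn₀, by positivity, fun n hn Hs _ => ?_⟩
  obtain ⟨t, ℓ, h1, h2, h3, h4, V, ξ, hV, hR2, hR3, hR4⟩ := h n hn Hs
  exact ⟨t, ℓ, h1, h2.trans (le_max_left _ _), h3, h4.trans (le_max_left _ _), V, labGraphs V ξ,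
    hV.cover, hV.disj, hV.sorted, hV.near,
    fun i j hij => ⟨fun α β hαβ => disjoint_labGraph (hV.disj i j hij.ne) hαβ, biUnion_labGraph⟩,
    fun i j hij α => hR2 i j hij.ne α, hR3, hR4⟩
end

section
/- (Supersaturation for bipartite graphs.) For every bipartite graph K and every d ∈ (0,1), there exist a constant ζ > 0 and a positive integer n₀ such that every n-vertex bipartite graph G = (A ∪ B, E) satisfying n ≥ n₀, |A| ≤ |B| ≤ |A| + 1, and e(G) ≥ d|A||B| contains at least ζ·n^{v(K)} distinct copies of K. -/
open Finset Filter

attribute [local instance] Classical.propDecidable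

/-- Jensen's inequality for powers, with the mean bounded below by `c`. -/
theorem pow_mul_card_le_sum_pow {β : Type*} (B : Finset β) (f : β → ℕ) {c : ℝ} (hc : 0 ≤ c)
    (h : c * B.card ≤ ((∑ b ∈ B, f b : ℕ) : ℝ)) (k : ℕ) :
    c ^ k * B.card ≤ ((∑ b ∈ B, f b ^ k : ℕ) : ℝ) := by
  rcases B.eq_empty_or_nonempty with rfl | hB
  · simp
  cases k with
  | zero => simp
  | succ k =>
    have hB' : (0 : ℝ) < B.card := by exact_mod_cast hB.card_pos
    push_cast at h ⊢
    refine le_trans ?_ (pow_sum_div_card_le_sum_pow (s := B) (f := fun b => (f b : ℝ)) (n := k)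
      (fun b _ => Nat.cast_nonneg _))
    rw [le_div_iff₀ (by positivity)]
    calc _ = (c * B.card) ^ (k + 1) := by ring
      _ ≤ _ := pow_le_pow_left₀ (by positivity) h _

theorem card_piFinset_const_eq {α ι : Type*} [Fintype ι] [DecidableEq ι] (A : Finset α) :
    (Fintype.piFinset fun _ : ι => A).card = A.card ^ Fintype.card ι := by
  simp [Fintype.card_piFinset]

/-- If the bipartite relation `r` has density at least `c`, then the relation of being adjacent to
every entry of a `ι`-tuple has density at least `c ^ |ι|`. -/
theorem density_pow_le_sum_card_piFinset {α β ι : Type*} [Fintype ι] (r : α → β → Prop)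
    (A : Finset α) (B : Finset β) {c : ℝ} (hc : 0 ≤ c)
    (h : c * A.card * B.card ≤ ((∑ b ∈ B, (A.filter fun a => r a b).card : ℕ) : ℝ)) :
    c ^ Fintype.card ι * (Fintype.piFinset fun _ : ι => A).card * B.card ≤
      ((∑ b ∈ B, ((Fintype.piFinset fun _ : ι => A).filter
        fun x => ∀ i, r (x i) b).card : ℕ) : ℝ) := by
  have key := pow_mul_card_le_sum_pow B _ (by positivity) h (Fintype.card ι)
  rw [mul_pow] at key
  have hcard : ∀ b, ((Fintype.piFinset fun _ : ι => A).filter fun x => ∀ i, r (x i) b).card =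
      (A.filter fun a => r a b).card ^ Fintype.card ι := fun b => by
    rw [← card_piFinset_const_eq (ι := ι)]
    refine congrArg Finset.card (Finset.ext fun x => ?_)
    simp [Fintype.mem_piFinset, forall_and]
  simpa only [hcard, card_piFinset_const_eq, Nat.cast_pow] using key

/-- The number of pairs of tuples spanning a complete bipartite pattern in a relation of density
at least `c`. -/
theorem density_pow_le_card_complete_pairs {α β ι κ : Type*} [Fintype ι] [Fintype κ]
    (r : α → β → Prop) (A : Finset α) (B : Finset β) {c : ℝ} (hc : 0 ≤ c)
    (h : c * A.card * B.card ≤ (((A ×ˢ B).filter fun p => r p.1 p.2).card : ℝ)) :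
    c ^ (Fintype.card ι * Fintype.card κ) * A.card ^ Fintype.card ι * B.card ^ Fintype.card κ ≤
      ((((Fintype.piFinset fun _ : ι => A) ×ˢ (Fintype.piFinset fun _ : κ => B)).filter
        fun p => ∀ i j, r (p.1 i) (p.2 j)).card : ℝ) := by
  have hprod := Finset.card_filter (fun p : α × β => r p.1 p.2) (A ×ˢ B)
  rw [Finset.sum_product_right] at hprod
  simp only [← Finset.card_filter] at hprod
  rw [hprod] at h
  have h1 := density_pow_le_sum_card_piFinset (ι := ι) r A B hc h
  have hswap := Finset.sum_card_bipartiteAbove_eq_sum_card_bipartiteBelow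
    (s := Fintype.piFinset fun _ : ι => A) (t := B) (fun x b => ∀ i, r (x i) b)
  simp only [Finset.bipartiteAbove, Finset.bipartiteBelow] at hswap
  rw [← hswap, mul_right_comm] at h1
  have h2 := density_pow_le_sum_card_piFinset (ι := κ) (fun b x => ∀ i, r (x i) b) B
    (Fintype.piFinset fun _ : ι => A) (pow_nonneg hc _) (by convert h1)
  have hprod' := Finset.card_filter (fun p : (ι → α) × (κ → β) => ∀ i j, r (p.1 i) (p.2 j))
    ((Fintype.piFinset fun _ : ι => A) ×ˢ (Fintype.piFinset fun _ : κ => B))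
  rw [Finset.sum_product] at hprod'
  simp only [← Finset.card_filter] at hprod'
  rw [hprod']
  rw [← pow_mul, card_piFinset_const_eq, card_piFinset_const_eq, Nat.cast_pow, Nat.cast_pow,
    mul_right_comm] at h2
  have hcomm : ∀ (x : ι → α) (y : κ → β), (∀ i j, r (x i) (y j)) ↔ ∀ j i, r (x i) (y j) :=
    fun x y => forall_comm
  simp only [hcomm]
  convert h2

/-- Few tuples with entries in `A` have a repeated entry. -/
theorem card_mul_card_not_injective_le {α ι : Type*} [Fintype ι] (A : Finset α) :
    A.card * ((Fintype.piFinset fun _ : ι => A).filter fun x => ¬ Function.Injective x).card ≤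
      Fintype.card ι ^ 2 * A.card ^ Fintype.card ι := by
  have hsub : ((Fintype.piFinset fun _ : ι => A).filter fun x => ¬ Function.Injective x) ⊆
      (Finset.univ : Finset (ι × ι)).biUnion fun q =>
        (Fintype.piFinset fun _ : ι => A).filter fun x => x q.1 = x q.2 ∧ q.1 ≠ q.2 := by
    intro x hx
    obtain ⟨hxA, hx⟩ := Finset.mem_filter.1 hx
    simp only [Function.Injective, not_forall] at hx
    obtain ⟨i, j, hij, hne⟩ := hx
    exact Finset.mem_biUnion.2 ⟨(i, j), Finset.mem_univ _, Finset.mem_filter.2 ⟨hxA, hij, hne⟩⟩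
  have hone : ∀ q : ι × ι, A.card * ((Fintype.piFinset fun _ : ι => A).filter
      fun x => x q.1 = x q.2 ∧ q.1 ≠ q.2).card ≤ A.card ^ Fintype.card ι := by
    intro q
    rw [← Finset.card_product, ← card_piFinset_const_eq (ι := ι)]
    refine Finset.card_le_card_of_injOn (fun p => Function.update p.2 q.2 p.1) ?_ ?_
    · rintro ⟨c, x⟩ hp
      simp only [Finset.coe_product, Set.mem_prod, Finset.mem_coe, Finset.mem_filter,
        Fintype.mem_piFinset] at hp ⊢
      intro i
      by_cases hi : i = q.2
      · subst hi; simpa using hp.1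
      · simpa [hi] using hp.2.1 i
    · rintro ⟨c, x⟩ hp ⟨c', x'⟩ hp' heq
      simp only [Finset.coe_product, Set.mem_prod, Finset.mem_coe, Finset.mem_filter] at hp hp'
      have hval : ∀ i, i ≠ q.2 → x i = x' i := fun i hi => by
        simpa [hi] using congrFun heq i
      have hc : c = c' := by simpa using congrFun heq q.2
      refine Prod.ext hc (funext fun i => ?_)
      by_cases hi : i = q.2
      · subst hi
        exact hp.2.2.1.symm.trans ((hval _ hp.2.2.2).trans hp'.2.2.1)
      · exact hval i hi
  calc _ ≤ A.card * ∑ q : ι × ι, ((Fintype.piFinset fun _ : ι => A).filter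
        fun x => x q.1 = x q.2 ∧ q.1 ≠ q.2).card :=
        Nat.mul_le_mul_left _ ((Finset.card_le_card hsub).trans Finset.card_biUnion_le)
    _ ≤ ∑ _q : ι × ι, A.card ^ Fintype.card ι := by
        rw [Finset.mul_sum]; exact Finset.sum_le_sum fun q _ => hone q
    _ = _ := by simp [sq]

/-- A relation of density at least `d` between two large sets contains many complete bipartite
patterns with distinct entries. -/
theorem half_density_pow_le_card_injective_pairs {α β ι κ : Type*} [Fintype ι] [Fintype κ]
    (r : α → β → Prop) (A : Finset α) (B : Finset β) {d : ℝ} (hd : 0 < d)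
    (h : d * A.card * B.card ≤ (((A ×ˢ B).filter fun p => r p.1 p.2).card : ℝ))
    (hA : 4 * (Fintype.card ι : ℝ) ^ 2 ≤ d ^ (Fintype.card ι * Fintype.card κ) * A.card)
    (hB : 4 * (Fintype.card κ : ℝ) ^ 2 ≤ d ^ (Fintype.card ι * Fintype.card κ) * B.card)
    (hA0 : 0 < A.card) (hB0 : 0 < B.card) :
    ∃ T : Finset ((ι → α) × (κ → β)),
      (∀ p ∈ T, (∀ i, p.1 i ∈ A) ∧ (∀ j, p.2 j ∈ B) ∧ (∀ i j, r (p.1 i) (p.2 j)) ∧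
        Function.Injective p.1 ∧ Function.Injective p.2) ∧
      d ^ (Fintype.card ι * Fintype.card κ) / 2 *
        (A.card ^ Fintype.card ι * B.card ^ Fintype.card κ) ≤ (T.card : ℝ) := by
  have hall := density_pow_le_card_complete_pairs (ι := ι) (κ := κ) r A B hd.le h
  have hx := card_mul_card_not_injective_le (ι := ι) A
  have hy := card_mul_card_not_injective_le (ι := κ) B
  set X := Fintype.piFinset fun _ : ι => A with hX
  set Y := Fintype.piFinset fun _ : κ => B with hY
  set X' := X.filter fun x => ¬ Function.Injective x
  set Y' := Y.filter fun x => ¬ Function.Injective x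
  have hsub : (X ×ˢ Y).filter (fun p => ∀ i j, r (p.1 i) (p.2 j)) ⊆
      (X ×ˢ Y).filter (fun p => (∀ i j, r (p.1 i) (p.2 j)) ∧ Function.Injective p.1 ∧
          Function.Injective p.2) ∪ (X' ×ˢ Y ∪ X ×ˢ Y') := by
    intro p hp
    simp only [X', Y', Finset.mem_union, Finset.mem_filter, Finset.mem_product] at hp ⊢
    tauto
  have hcard := (Finset.card_le_card hsub).trans ((Finset.card_union_le _ _).trans
    (Nat.add_le_add_left (Finset.card_union_le _ _) _))
  rw [Finset.card_product, Finset.card_product] at hcard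
  have hXc : X.card = A.card ^ Fintype.card ι := card_piFinset_const_eq _
  have hYc : Y.card = B.card ^ Fintype.card κ := card_piFinset_const_eq _
  rw [← hXc] at hx
  rw [← hYc] at hy
  have hcard' : (_ : ℝ) ≤ _ := Nat.cast_le.2 hcard
  have hx' : (_ : ℝ) ≤ _ := Nat.cast_le.2 hx
  have hy' : (_ : ℝ) ≤ _ := Nat.cast_le.2 hy
  rw [mul_assoc, ← Nat.cast_pow, ← Nat.cast_pow, ← hXc, ← hYc] at hall
  rw [← Nat.cast_pow, ← Nat.cast_pow, ← hXc, ← hYc]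
  push_cast at hcard' hx' hy'
  have hA0' : (0 : ℝ) < A.card := by exact_mod_cast hA0
  have hB0' : (0 : ℝ) < B.card := by exact_mod_cast hB0
  set D := d ^ (Fintype.card ι * Fintype.card κ)
  have hx2 : (X'.card : ℝ) ≤ D / 4 * X.card := by
    refine le_of_mul_le_mul_left ?_ hA0'
    nlinarith [mul_le_mul_of_nonneg_right hA (Nat.cast_nonneg (α := ℝ) X.card)]
  have hy2 : (Y'.card : ℝ) ≤ D / 4 * Y.card := by
    refine le_of_mul_le_mul_left ?_ hB0'
    nlinarith [mul_le_mul_of_nonneg_right hB (Nat.cast_nonneg (α := ℝ) Y.card)]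
  refine ⟨(X ×ˢ Y).filter fun p => (∀ i j, r (p.1 i) (p.2 j)) ∧ Function.Injective p.1 ∧
    Function.Injective p.2, fun p hp => ?_, ?_⟩
  · simpa [hX, hY, Fintype.mem_piFinset, and_assoc] using hp
  nlinarith [mul_le_mul_of_nonneg_right hx2 (Nat.cast_nonneg (α := ℝ) Y.card),
    mul_le_mul_of_nonneg_left hy2 (Nat.cast_nonneg (α := ℝ) X.card)]

/-- The vertex map glued from a tuple indexed by `P` and a tuple indexed by `Q`. -/
noncomputable def glueMap (P Q : Finset ℕ) (p : (↥P → ℕ) × (↥Q → ℕ)) (k : ℕ) : ℕ :=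
  if h : k ∈ P then p.1 ⟨k, h⟩ else if h : k ∈ Q then p.2 ⟨k, h⟩ else 0

theorem glueMap_left {P Q : Finset ℕ} (p : (↥P → ℕ) × (↥Q → ℕ)) (i : ↥P) :
    glueMap P Q p i = p.1 i := by
  simp [glueMap]

theorem glueMap_right {P Q : Finset ℕ} (hPQ : Disjoint P Q) (p : (↥P → ℕ) × (↥Q → ℕ)) (j : ↥Q) :
    glueMap P Q p j = p.2 j := by
  simp [glueMap, Finset.disjoint_right.1 hPQ j.2]

theorem injOn_glueMap {P Q A B : Finset ℕ} (hPQ : Disjoint P Q) (hAB : Disjoint A B)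
    {p : (↥P → ℕ) × (↥Q → ℕ)} (h1 : ∀ i, p.1 i ∈ A) (h2 : ∀ j, p.2 j ∈ B)
    (hi1 : Function.Injective p.1) (hi2 : Function.Injective p.2) :
    Set.InjOn (glueMap P Q p) ↑(P ∪ Q) := by
  intro k hk l hl hkl
  rcases Finset.mem_union.1 hk with hk | hk <;> rcases Finset.mem_union.1 hl with hl | hl
  · rw [glueMap_left p ⟨k, hk⟩, glueMap_left p ⟨l, hl⟩] at hkl
    exact congrArg Subtype.val (hi1 hkl)
  · rw [glueMap_left p ⟨k, hk⟩, glueMap_right hPQ p ⟨l, hl⟩] at hkl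
    exact absurd (h2 ⟨l, hl⟩) (Finset.disjoint_left.1 hAB (hkl ▸ h1 ⟨k, hk⟩))
  · rw [glueMap_right hPQ p ⟨k, hk⟩, glueMap_left p ⟨l, hl⟩] at hkl
    exact absurd (h2 ⟨k, hk⟩) (Finset.disjoint_left.1 hAB (hkl ▸ h1 ⟨l, hl⟩))
  · rw [glueMap_right hPQ p ⟨k, hk⟩, glueMap_right hPQ p ⟨l, hl⟩] at hkl
    exact congrArg Subtype.val (hi2 hkl)

/-- A set meeting each of `P` and `Q` in one point is mapped to an edge as soon as the two tuples
are completely joined. -/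
theorem image_glueMap_mem {P Q e : Finset ℕ} {G : Finset (Finset ℕ)} (hPQ : Disjoint P Q)
    {p : (↥P → ℕ) × (↥Q → ℕ)} (hG : ∀ i j, ({p.1 i, p.2 j} : Finset ℕ) ∈ G)
    (hsub : e ⊆ P ∪ Q) (hP : (e ∩ P).card = 1) (hQ : (e ∩ Q).card = 1) :
    e.image (glueMap P Q p) ∈ G := by
  obtain ⟨i, hi⟩ := Finset.card_eq_one.1 hP
  obtain ⟨j, hj⟩ := Finset.card_eq_one.1 hQ
  have hiP : i ∈ P := (Finset.mem_inter.1 (hi ▸ Finset.mem_singleton_self i)).2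
  have hjQ : j ∈ Q := (Finset.mem_inter.1 (hj ▸ Finset.mem_singleton_self j)).2
  have he : e = {i, j} := by
    rw [← Finset.inter_eq_left.2 hsub, Finset.inter_union_distrib_left, hi, hj]
    rfl
  rw [he, Finset.image_insert, Finset.image_singleton, glueMap_left p ⟨i, hiP⟩,
    glueMap_right hPQ p ⟨j, hjQ⟩]
  exact hG _ _

/-- At most `|C| ^ |P ∪ Q|` pairs of tuples have their glued map onto `C`. -/
theorem card_filter_image_glueMap_le {P Q : Finset ℕ} (hPQ : Disjoint P Q)
    (T : Finset ((↥P → ℕ) × (↥Q → ℕ))) (C : Finset ℕ)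
    (hT : ∀ p ∈ T, (P ∪ Q).image (glueMap P Q p) = C) :
    T.card ≤ (P ∪ Q).card ^ (P ∪ Q).card := by
  rcases T.eq_empty_or_nonempty with rfl | ⟨p₀, hp₀⟩
  · simp
  have hC : C.card ≤ (P ∪ Q).card := hT p₀ hp₀ ▸ Finset.card_image_le
  have hsub : T ⊆ (Fintype.piFinset fun _ : ↥P => C) ×ˢ (Fintype.piFinset fun _ : ↥Q => C) := by
    intro p hp
    rw [Finset.mem_product, Fintype.mem_piFinset, Fintype.mem_piFinset]
    refine ⟨fun i => ?_, fun j => ?_⟩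
    · rw [← hT p hp, ← glueMap_left p i]
      exact Finset.mem_image_of_mem _ (Finset.mem_union_left _ i.2)
    · rw [← hT p hp, ← glueMap_right hPQ p j]
      exact Finset.mem_image_of_mem _ (Finset.mem_union_right _ j.2)
  calc T.card ≤ _ := Finset.card_le_card hsub
    _ = C.card ^ (P ∪ Q).card := by
      rw [Finset.card_product, card_piFinset_const_eq, card_piFinset_const_eq,
        Fintype.card_coe, Fintype.card_coe, ← pow_add, Finset.card_union_of_disjoint hPQ]
    _ ≤ _ := Nat.pow_le_pow_left hC _

/-- (Supersaturation for bipartite graphs.) -/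
theorem bipartite_supersaturation (KV : Finset ℕ) (KE : Finset (Finset ℕ))
    (hK : ∀ e ∈ KE, e ⊆ KV ∧ e.card = 2)
    (hKbip : ∃ Pp Qq : Finset ℕ, Disjoint Pp Qq ∧ Pp ∪ Qq = KV ∧
      ∀ e ∈ KE, (e ∩ Pp).card = 1 ∧ (e ∩ Qq).card = 1)
    (d : ℝ) (hd0 : 0 < d) (hd1 : d < 1) :
    ∃ ζ : ℝ, 0 < ζ ∧ ∃ n₀ : ℕ, 0 < n₀ ∧ ∀ n : ℕ, n₀ ≤ n →
      ∀ A B : Finset ℕ, ∀ G : Finset (Finset ℕ),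
        Disjoint A B → (A ∪ B).card = n →
        (∀ e ∈ G, ∃ a ∈ A, ∃ b ∈ B, e = {a, b}) →
        A.card ≤ B.card → B.card ≤ A.card + 1 →
        d * A.card * B.card ≤ (G.card : ℝ) →
        ∃ S : Finset (Finset ℕ × Finset (Finset ℕ)),
          (∀ c ∈ S, c.1 ⊆ A ∪ B ∧ c.2 ⊆ G ∧ IsCopy2 KV KE c.1 c.2) ∧
          ζ * (n : ℝ) ^ KV.card ≤ (S.card : ℝ) := by
  obtain ⟨P, Q, hPQ, rfl, hcross⟩ := hKbip
  set v := (P ∪ Q).card with hv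
  have hvpq : v = P.card + Q.card := Finset.card_union_of_disjoint hPQ
  set D : ℝ := d ^ (P.card * Q.card) with hD
  have hDpos : 0 < D := pow_pos hd0 _
  have hvv : (0 : ℝ) < (v : ℝ) ^ v := by
    exact_mod_cast (Nat.pow_self_pos : 0 < v ^ v)
  obtain ⟨N, hN⟩ := exists_nat_ge (4 * (v : ℝ) ^ 2 / D)
  refine ⟨D / 2 / 3 ^ v / v ^ v, by positivity, 3 * N + 3, by omega, ?_⟩
  intro n hn A B G hAB hABn hG hle hle1 hdens
  rw [Finset.card_union_of_disjoint hAB] at hABn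
  have hnA : n ≤ 3 * A.card := by omega
  have hNA : N ≤ A.card := by omega
  have hlarge : ∀ m k : ℕ, N ≤ m → k ≤ v → 4 * (k : ℝ) ^ 2 ≤ D * m := fun m k hm hk => by
    have hm' : (N : ℝ) ≤ m := by exact_mod_cast hm
    have hk' : (k : ℝ) ≤ v := by exact_mod_cast hk
    have := (div_le_iff₀ hDpos).1 (hN.trans hm')
    nlinarith [pow_le_pow_left₀ (Nat.cast_nonneg k) hk' 2]
  have hdens' : d * A.card * B.card ≤
      (((A ×ˢ B).filter fun p => ({p.1, p.2} : Finset ℕ) ∈ G).card : ℝ) := by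
    refine hdens.trans (Nat.cast_le.2 ?_)
    refine Finset.card_le_card_of_surjOn (fun p => ({p.1, p.2} : Finset ℕ)) ?_
    intro e he
    obtain ⟨a, ha, b, hb, rfl⟩ := hG e he
    exact ⟨(a, b), by simpa [ha, hb] using he, rfl⟩
  obtain ⟨T, hT, hcount⟩ := half_density_pow_le_card_injective_pairs (ι := ↥P) (κ := ↥Q)
    (fun a b => ({a, b} : Finset ℕ) ∈ G) A B hd0 (by convert hdens')
    (by simpa using hlarge _ _ hNA (by omega)) (by simpa using hlarge _ _ (by omega) (by omega))
    (by omega) (by omega)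
  simp only [Fintype.card_coe] at hcount
  let F : (↥P → ℕ) × (↥Q → ℕ) → Finset ℕ × Finset (Finset ℕ) := fun p =>
    ((P ∪ Q).image (glueMap P Q p), KE.image fun e => e.image (glueMap P Q p))
  refine ⟨T.image F, ?_, ?_⟩
  · intro c hc
    obtain ⟨p, hp, rfl⟩ := Finset.mem_image.1 hc
    obtain ⟨h1, h2, hpG, hi1, hi2⟩ := hT p hp
    refine ⟨?_, ?_, glueMap P Q p, injOn_glueMap hPQ hAB h1 h2 hi1 hi2, rfl, rfl⟩
    · refine Finset.image_subset_iff.2 fun k hk => ?_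
      rcases Finset.mem_union.1 hk with hk | hk
      · rw [glueMap_left p ⟨k, hk⟩]
        exact Finset.mem_union_left _ (h1 _)
      · rw [glueMap_right hPQ p ⟨k, hk⟩]
        exact Finset.mem_union_right _ (h2 _)
    · exact Finset.image_subset_iff.2 fun e he =>
        image_glueMap_mem hPQ hpG (hK e he).1 (hcross e he).1 (hcross e he).2
  · have hfib := Finset.card_le_mul_card_image (f := F) T (v ^ v) fun c _ =>
      card_filter_image_glueMap_le hPQ _ c.1 fun p hp =>
        congrArg Prod.fst (Finset.mem_filter.1 hp).2
    have hfib' : (T.card : ℝ) ≤ (v : ℝ) ^ v * (T.image F).card := by exact_mod_cast hfib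
    have hA3 : (n : ℝ) / 3 ≤ A.card := by
      rw [div_le_iff₀ (by norm_num), mul_comm]; exact_mod_cast hnA
    have hB3 : (n : ℝ) / 3 ≤ B.card := hA3.trans (by exact_mod_cast hle)
    have hpow : ((n : ℝ) / 3) ^ v ≤ (A.card : ℝ) ^ P.card * (B.card : ℝ) ^ Q.card := by
      rw [hvpq, pow_add]
      gcongr
    calc D / 2 / 3 ^ v / v ^ v * (n : ℝ) ^ v = D / 2 * ((n : ℝ) / 3) ^ v / (v : ℝ) ^ v := by
          rw [div_pow]; ring
      _ ≤ T.card / (v : ℝ) ^ v := by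
          gcongr
          exact (mul_le_mul_of_nonneg_left hpow (by positivity)).trans hcount
      _ ≤ (T.image F).card := by
          rw [div_le_iff₀ hvv, mul_comm]; exact hfib'
end
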